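/- arXiv:2106.04359 — 8 statements merged into one kernel-verified Lean document; each statement's English description precedes it below -/
import Mathlib

section
/- Assume 𝓡₀ > 1 and define c_* := min_{γ>0} [η(𝓡₀ - 1) + λ(e^{-γ} - 2 + e^{γ})]/γ. Then for every c ∈ (0, c_*) there is no traveling wave solution, i.e. no smooth functions S, I : ℝ → ℝ with 0 < S(x) < s₀, I(x) > 0 bounded, satisfying -c S'(x) = -τ S(x) I(x) and -c I'(x) = τ S(x) I(x) - η I(x) + λ(I(x-1) - 2 I(x) + I(x+1)) for all x ∈ ℝ, with S(x) → s₀ as x → +∞ and I(x) → 0 as x → ±∞. -/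
/-- A traveling wave solution of speed `c` for the lattice SIR system: smooth profiles
`S, I : ℝ → ℝ` with `0 < S < s₀`, `I > 0` bounded, satisfying
`-c S' = -τ S I` and `-c I' = τ S I - η I + λ(I(·-1) - 2 I + I(·+1))` on `ℝ`,
with `S(+∞) = s₀` and `I(±∞) = 0`. -/
def IsTravelingWave (τ η lam s₀ c : ℝ) (S I : ℝ → ℝ) : Prop :=
  ContDiff ℝ (⊤ : ℕ∞) S ∧ ContDiff ℝ (⊤ : ℕ∞) I ∧
  (∀ x, 0 < S x ∧ S x < s₀) ∧ (∀ x, 0 < I x) ∧ (∃ M : ℝ, ∀ x, I x ≤ M) ∧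
  (∀ x : ℝ, -c * deriv S x = -τ * S x * I x) ∧
  (∀ x : ℝ, -c * deriv I x =
      τ * S x * I x - η * I x + lam * (I (x - 1) - 2 * I x + I (x + 1))) ∧
  Filter.Tendsto S Filter.atTop (nhds s₀) ∧
  Filter.Tendsto I Filter.atTop (nhds 0) ∧
  Filter.Tendsto I Filter.atBot (nhds 0)

open intervalIntegral in
theorem key_aux (c d lam γ ω : ℝ) (hlam : 0 < lam) (hω : 0 < ω) (hωπ : ω < Real.pi)
    (J : ℝ → ℝ) (hJ : ContDiff ℝ 1 J) (hpos : ∀ x, 0 < J x)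
    (hineq : ∀ x, 0 ≤ x → d * J x + lam * (J (x - 1) - 2 * J x + J (x + 1)) ≤ -c * deriv J x)
    (hB : lam * (Real.exp γ - Real.exp (-γ)) * Real.sin ω = c * ω)
    (hA : 0 < d + lam * ((Real.exp γ + Real.exp (-γ)) * Real.cos ω - 2) - c * γ) : False := by
  obtain ⟨L, hL⟩ : ∃ L, L = Real.pi / ω := ⟨_, rfl⟩
  have hωL : ω * L = Real.pi := by rw [hL]; field_simp
  have hL1 : 1 < L := by rw [hL, lt_div_iff₀ hω]; linarith
  obtain ⟨ψ, hψ⟩ : ∃ ψ : ℝ → ℝ, ψ = fun x => Real.exp (γ * x) * Real.sin (ω * x) := ⟨_, rfl⟩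
  have hψc : Continuous ψ := by rw [hψ]; fun_prop
  have hJc : Continuous J := hJ.continuous
  have hJ'c : Continuous (deriv J) := hJ.continuous_deriv (le_refl _)
  obtain ⟨ψ', hψ'⟩ : ∃ ψ' : ℝ → ℝ, ψ' = fun x => γ * ψ x + ω * (Real.exp (γ * x) * Real.cos (ω * x)) := ⟨_, rfl⟩
  have hψ'c : Continuous ψ' := by rw [hψ']; fun_prop
  have hder : ∀ x, HasDerivAt ψ (ψ' x) x := by
    intro x
    have h1 : HasDerivAt (fun x : ℝ => γ * x) γ x := by simpa using (hasDerivAt_id x).const_mul γ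
    have h2 : HasDerivAt (fun x : ℝ => ω * x) ω x := by simpa using (hasDerivAt_id x).const_mul ω
    have := h1.exp.mul h2.sin
    have e : ψ' x = Real.exp (γ * x) * γ * Real.sin (ω * x)
        + Real.exp (γ * x) * (Real.cos (ω * x) * ω) := by
      simp only [hψ', hψ]; ring
    rw [e, hψ]
    exact this
  have hψ0 : ψ 0 = 0 := by simp [hψ]
  have hψL : ψ L = 0 := by simp [hψ, hωL]
  have hnn : ∀ x, 0 ≤ x → x ≤ L → 0 ≤ ψ x := by
    intro x h0 h1
    rw [hψ]
    refine mul_nonneg (Real.exp_pos _).le (Real.sin_nonneg_of_nonneg_of_le_pi (by positivity) ?_)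
    rw [← hωL]; gcongr
  have hpp : ∀ x, 0 < x → x < L → 0 < ψ x := by
    intro x h0 h1
    rw [hψ]
    refine mul_pos (Real.exp_pos _) (Real.sin_pos_of_pos_of_lt_pi (by positivity) ?_)
    rw [← hωL]; gcongr
  have hneg1 : ∀ x, -1 ≤ x → x ≤ 0 → ψ x ≤ 0 := by
    intro x h0 h1
    rw [hψ]
    refine mul_nonpos_of_nonneg_of_nonpos (Real.exp_pos _).le
      (Real.sin_nonpos_of_nonpos_of_neg_pi_le (by nlinarith) (by nlinarith))
  have hneg2 : ∀ x, L ≤ x → x ≤ L + 1 → ψ x ≤ 0 := by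
    intro x h0 h1
    rw [hψ]
    refine mul_nonpos_of_nonneg_of_nonpos (Real.exp_pos _).le ?_
    have : Real.sin (ω * x) = - Real.sin (ω * x - Real.pi) := by rw [Real.sin_sub_pi]; ring
    rw [this]
    have := Real.sin_nonneg_of_nonneg_of_le_pi (x := ω * x - Real.pi) (by nlinarith) (by nlinarith)
    linarith
  have hop : ∀ x, d * ψ x + lam * (ψ (x + 1) - 2 * ψ x + ψ (x - 1)) - c * ψ' x
      = (d + lam * ((Real.exp γ + Real.exp (-γ)) * Real.cos ω - 2) - c * γ) * ψ x := by
    intro x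
    have e1 : ψ (x + 1) = Real.exp (γ * x) * Real.exp γ *
        (Real.sin (ω * x) * Real.cos ω + Real.cos (ω * x) * Real.sin ω) := by
      rw [hψ, ← Real.exp_add, ← Real.sin_add]; ring_nf
    have e2 : ψ (x - 1) = Real.exp (γ * x) * Real.exp (-γ) *
        (Real.sin (ω * x) * Real.cos ω - Real.cos (ω * x) * Real.sin ω) := by
      rw [hψ, ← Real.exp_add, ← Real.sin_sub]; ring_nf
    rw [e1, e2, hψ']
    simp only [hψ]
    linear_combination (Real.exp (γ * x) * Real.cos (ω * x)) * hB
  have ii : ∀ (f : ℝ → ℝ) (_ : Continuous f) (a b : ℝ), IntervalIntegrable f MeasureTheory.volume a b :=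
    fun f hf a b => hf.intervalIntegrable a b
  -- integration by parts
  have hparts : ∫ x in (0:ℝ)..L, ψ x * deriv J x = - ∫ x in (0:ℝ)..L, ψ' x * J x := by
    rw [integral_mul_deriv_eq_deriv_mul (u' := ψ') (fun x _ => hder x)
      (fun x _ => (hJ.differentiable one_ne_zero x).hasDerivAt) (ii _ hψ'c _ _) (ii _ hJ'c _ _)]
    simp [hψ0, hψL]
  have hs1 : ∫ x in (0:ℝ)..L, ψ (x + 1) * J x ≤ ∫ x in (0:ℝ)..L, ψ x * J (x - 1) := by
    have c1 : Continuous fun x => ψ (x + 1) * J x := by fun_prop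
    have e : ∫ x in (0:ℝ)..L, ψ x * J (x - 1) = ∫ x in (-1:ℝ)..(L - 1), ψ (x + 1) * J x := by
      have := integral_comp_sub_right (a := 0) (b := L) (fun x => ψ (x + 1) * J x) 1
      simpa using this
    rw [e, ← integral_add_adjacent_intervals (ii _ c1 (-1) 0) (ii _ c1 0 (L - 1)),
      ← integral_add_adjacent_intervals (ii _ c1 0 (L - 1)) (ii _ c1 (L - 1) L)]
    have p1 : 0 ≤ ∫ x in (-1:ℝ)..0, ψ (x + 1) * J x :=
      integral_nonneg (by norm_num) fun x hx =>
        mul_nonneg (hnn _ (by linarith [hx.1]) (by linarith [hx.2])) (hpos x).le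
    have p2 : ∫ x in (L - 1)..L, ψ (x + 1) * J x ≤ 0 := by
      have : 0 ≤ ∫ x in (L - 1)..L, -(ψ (x + 1) * J x) :=
        integral_nonneg (by linarith) fun x hx => by
          have := mul_nonpos_of_nonpos_of_nonneg
            (hneg2 (x + 1) (by linarith [hx.1]) (by linarith [hx.2])) (hpos x).le
          linarith
      rw [integral_neg] at this
      linarith
    linarith
  have hs2 : ∫ x in (0:ℝ)..L, ψ (x - 1) * J x ≤ ∫ x in (0:ℝ)..L, ψ x * J (x + 1) := by
    have c1 : Continuous fun x => ψ (x - 1) * J x := by fun_prop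
    have e : ∫ x in (0:ℝ)..L, ψ x * J (x + 1) = ∫ x in (1:ℝ)..(L + 1), ψ (x - 1) * J x := by
      have := integral_comp_add_right (a := 0) (b := L) (fun x => ψ (x - 1) * J x) 1
      simpa using this
    rw [e, ← integral_add_adjacent_intervals (ii _ c1 0 1) (ii _ c1 1 L),
      ← integral_add_adjacent_intervals (ii _ c1 1 L) (ii _ c1 L (L + 1))]
    have p1 : 0 ≤ ∫ x in L..(L + 1), ψ (x - 1) * J x :=
      integral_nonneg (by linarith) fun x hx =>
        mul_nonneg (hnn _ (by linarith [hx.1]) (by linarith [hx.2])) (hpos x).le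
    have p2 : ∫ x in (0:ℝ)..1, ψ (x - 1) * J x ≤ 0 := by
      have : 0 ≤ ∫ x in (0:ℝ)..1, -(ψ (x - 1) * J x) :=
        integral_nonneg (by linarith) fun x hx => by
          have := mul_nonpos_of_nonpos_of_nonneg
            (hneg1 (x - 1) (by linarith [hx.1]) (by linarith [hx.2])) (hpos x).le
          linarith
      rw [integral_neg] at this
      linarith
    linarith
  have hmain : 0 ≤ ∫ x in (0:ℝ)..L, ((-c) * (ψ x * deriv J x) - (d - 2 * lam) * (ψ x * J x)
      - lam * (ψ x * J (x - 1)) - lam * (ψ x * J (x + 1))) := by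
    refine integral_nonneg (by linarith) fun x hx => ?_
    have := mul_le_mul_of_nonneg_left (hineq x hx.1) (hnn x hx.1 hx.2)
    linarith
  have k1 : Continuous fun x => ψ x * deriv J x := by fun_prop
  have k2 : Continuous fun x => ψ x * J x := by fun_prop
  have k3 : Continuous fun x => ψ x * J (x - 1) := by fun_prop
  have k4 : Continuous fun x => ψ x * J (x + 1) := by fun_prop
  have k5 : Continuous fun x => ψ (x + 1) * J x := by fun_prop
  have k6 : Continuous fun x => ψ (x - 1) * J x := by fun_prop
  have k7 : Continuous fun x => ψ' x * J x := by fun_prop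
  rw [integral_sub (ii _ (by fun_prop) _ _) (ii _ (by fun_prop) _ _),
    integral_sub (ii _ (by fun_prop) _ _) (ii _ (by fun_prop) _ _),
    integral_sub (ii _ (by fun_prop) _ _) (ii _ (by fun_prop) _ _),
    integral_const_mul, integral_const_mul, integral_const_mul, integral_const_mul, hparts] at hmain
  have hq : ∫ x in (0:ℝ)..L, ((d - 2 * lam) * (ψ x * J x) + lam * (ψ (x + 1) * J x)
      + lam * (ψ (x - 1) * J x) - c * (ψ' x * J x))
      = (d + lam * ((Real.exp γ + Real.exp (-γ)) * Real.cos ω - 2) - c * γ) *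
        ∫ x in (0:ℝ)..L, ψ x * J x := by
    rw [← integral_const_mul]
    congr 1
    ext x
    linear_combination J x * hop x
  rw [integral_sub (ii _ (by fun_prop) _ _) (ii _ (by fun_prop) _ _),
    integral_add (ii _ (by fun_prop) _ _) (ii _ (by fun_prop) _ _),
    integral_add (ii _ (by fun_prop) _ _) (ii _ (by fun_prop) _ _),
    integral_const_mul, integral_const_mul, integral_const_mul, integral_const_mul] at hq
  have hP : 0 < ∫ x in (0:ℝ)..L, ψ x * J x :=
    intervalIntegral_pos_of_pos_on (ii _ k2 _ _)
      (fun x hx => mul_pos (hpp x hx.1 hx.2) (hpos x)) (by linarith)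
  have h1 := mul_le_mul_of_nonneg_left hs1 hlam.le
  have h2 := mul_le_mul_of_nonneg_left hs2 hlam.le
  have h3 := mul_pos hA hP
  linarith

theorem exists_omega (c d lam : ℝ) (hlam : 0 < lam) (hc : 0 < c)
    (h : ∀ γ, 0 < γ → c * γ < d + lam * (Real.exp (-γ) - 2 + Real.exp γ)) :
    ∃ γ ω : ℝ, 0 < ω ∧ ω < Real.pi ∧
      lam * (Real.exp γ - Real.exp (-γ)) * Real.sin ω = c * ω ∧
      0 < d + lam * ((Real.exp γ + Real.exp (-γ)) * Real.cos ω - 2) - c * γ := by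
  obtain ⟨g, hg⟩ : ∃ g : ℝ → ℝ, g = fun ω => Real.arsinh (c / (2 * lam * Real.sinc ω)) := ⟨_, rfl⟩
  have hgc : ContinuousAt g 0 := by
    rw [hg]
    refine Real.continuous_arsinh.continuousAt.comp ?_
    refine ContinuousAt.div continuousAt_const ?_ ?_
    · exact (continuous_const.mul Real.continuous_sinc).continuousAt
    · simp [hlam.ne']
  have hg0 : 0 < g 0 := by
    rw [hg]; simp only [Real.sinc_zero, Real.arsinh_pos_iff]; positivity
  have hFc : ContinuousAt (fun ω => d + lam * ((Real.exp (g ω) + Real.exp (-g ω)) * Real.cos ω - 2)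
      - c * g ω) 0 := by fun_prop
  have hF0 := hFc.eventually_const_lt (u := 0) (by
    have := h _ hg0
    simp only [Real.cos_zero]; linarith)
  have hev := (hF0.filter_mono (nhdsWithin_le_nhds (s := Set.Ioi 0))).and
    (Ioo_mem_nhdsGT Real.pi_pos)
  obtain ⟨ω, h1, h2, h3⟩ := hev.exists
  refine ⟨g ω, ω, h2, h3, ?_, h1⟩
  have hs := Real.sin_pos_of_pos_of_lt_pi h2 h3
  have : Real.sinh (g ω) = c / (2 * lam * (Real.sin ω / ω)) := by
    rw [hg]; simp only [Real.sinh_arsinh, Real.sinc_of_ne_zero h2.ne']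
  rw [Real.sinh_eq] at this
  have e : Real.exp (g ω) - Real.exp (-g ω) = 2 * (c / (2 * lam * (Real.sin ω / ω))) := by linarith
  rw [e]; field_simp

/-- Assume `𝓡₀ = s₀τ/η > 1` and let `c_* = min_{γ>0} [η(𝓡₀-1) + λ(e^{-γ}-2+e^{γ})]/γ`.
Then no traveling wave solution exists with speed `c ∈ (0, c_*)`. -/
theorem stmt_7 (τ η lam s₀ : ℝ) (hτ : 0 < τ) (hη : 0 < η) (hlam : 0 < lam)
    (hs₀ : s₀ ∈ Set.Ioo (0 : ℝ) 1) (hR0 : 1 < s₀ * τ / η)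
    (cstar : ℝ)
    (hcstar : IsLeast {v : ℝ | ∃ γ : ℝ, 0 < γ ∧
        v = (η * (s₀ * τ / η - 1) + lam * (Real.exp (-γ) - 2 + Real.exp γ)) / γ} cstar) :
    ∀ c : ℝ, 0 < c → c < cstar →
      ¬ ∃ S I : ℝ → ℝ, IsTravelingWave τ η lam s₀ c S I := by
  rintro c hc hcs ⟨S, I, -, hI, -, hIpos, -, -, hIeq, hSlim, -, -⟩
  have hd : η * (s₀ * τ / η - 1) = s₀ * τ - η := by field_simp
  obtain ⟨γ, ω, h1, h2, h3, h4⟩ := exists_omega c (s₀ * τ - η) lam hlam hc (by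
    intro γ hγ
    have h := hcstar.2 ⟨γ, hγ, rfl⟩
    rw [hd] at h
    have h' := hcs.trans_le h
    rwa [lt_div_iff₀ hγ] at h')
  obtain ⟨A, hA⟩ : ∃ A, A = (s₀ * τ - η) + lam * ((Real.exp γ + Real.exp (-γ)) * Real.cos ω - 2)
    - c * γ := ⟨_, rfl⟩
  rw [← hA] at h4
  have hlim : Filter.Tendsto (fun x => S x * τ - η) Filter.atTop (nhds (s₀ * τ - η)) :=
    (hSlim.mul_const τ).sub_const η
  obtain ⟨X, hX⟩ := Filter.eventually_atTop.1
    (hlim.eventually_const_lt (show s₀ * τ - η - A / 2 < s₀ * τ - η by linarith))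
  refine key_aux c (s₀ * τ - η - A / 2) lam γ ω hlam h1 h2 (fun x => I (x + X)) ?_
    (fun x => hIpos _) ?_ h3 (by linarith)
  · exact (hI.of_le (by exact_mod_cast le_top)).comp (contDiff_id.add contDiff_const)
  · intro x hx
    rw [deriv_comp_add_const, hIeq, show x - 1 + X = x + X - 1 by ring,
      show x + 1 + X = x + X + 1 by ring]
    have := mul_lt_mul_of_pos_right (hX (x + X) (by linarith)) (hIpos (x + X))
    linarith
end

section
/- Let c > 0 and let S, I : ℝ → ℝ be smooth functions with 0 < S(x) < s₀, I(x) > 0 bounded, satisfying -c S'(x) = -τ S(x) I(x) and -c I'(x) = τ S(x) I(x) - η I(x) + λ(I(x-1) - 2 I(x) + I(x+1)) for all x ∈ ℝ, with S(x) → s₀ as x → +∞ and I(x) → 0 as x → ±∞, and assume I is integrable on ℝ. Then S is strictly increasing, the limit s_∞ := lim_{x→-∞} S(x) exists with 0 < s_∞ < s₀, I(x) = c S'(x)/(τ S(x)) for all x, and Ψ(s_∞) = Ψ(s₀), where Ψ(v) := v - (η/τ) ln v. -/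
/-- Basic properties of traveling wave profiles for the lattice SIR system:
`S` is strictly increasing, the limit `s_∞ = S(-∞)` exists with `0 < s_∞ < s₀`,
`I = c S'/(τ S)`, and `Ψ(s_∞) = Ψ(s₀)` where `Ψ(v) = v - (η/τ) ln v`. -/
theorem stmt_8 (τ η lam s₀ : ℝ) (hτ : 0 < τ) (hη : 0 < η) (hlam : 0 < lam)
    (hs₀ : s₀ ∈ Set.Ioo (0 : ℝ) 1)
    (c : ℝ) (hc : 0 < c)
    (S I : ℝ → ℝ)
    (hSsmooth : ContDiff ℝ (⊤ : ℕ∞) S) (hIsmooth : ContDiff ℝ (⊤ : ℕ∞) I)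
    (hSrange : ∀ x, 0 < S x ∧ S x < s₀)
    (hIpos : ∀ x, 0 < I x) (hIbdd : ∃ M : ℝ, ∀ x, I x ≤ M)
    (hodeS : ∀ x : ℝ, -c * deriv S x = -τ * S x * I x)
    (hodeI : ∀ x : ℝ, -c * deriv I x =
        τ * S x * I x - η * I x + lam * (I (x - 1) - 2 * I x + I (x + 1)))
    (hSlim : Filter.Tendsto S Filter.atTop (nhds s₀))
    (hIlimTop : Filter.Tendsto I Filter.atTop (nhds 0))
    (hIlimBot : Filter.Tendsto I Filter.atBot (nhds 0))
    (hIint : MeasureTheory.Integrable I) :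
    StrictMono S ∧
    (∀ x : ℝ, I x = c * deriv S x / (τ * S x)) ∧
    ∃ sinf : ℝ, 0 < sinf ∧ sinf < s₀ ∧
      Filter.Tendsto S Filter.atBot (nhds sinf) ∧
      sinf - η / τ * Real.log sinf = s₀ - η / τ * Real.log s₀ := by
  have hS1 : ∀ x, HasDerivAt S (deriv S x) x := fun x =>
    ((hSsmooth.differentiable (by simp)) x).hasDerivAt
  have hI1 : ∀ x, HasDerivAt I (deriv I x) x := fun x =>
    ((hIsmooth.differentiable (by simp)) x).hasDerivAt
  have hdS : ∀ x, deriv S x = τ / c * I x * S x := by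
    intro x
    have := hodeS x
    field_simp
    linarith
  have hmono : StrictMono S := by
    apply strictMono_of_deriv_pos
    intro x
    rw [hdS]
    have := hIpos x
    have := (hSrange x).1
    positivity
  have hL : ∀ x, HasDerivAt (fun y => Real.log (S y)) (τ / c * I x) x := by
    intro x
    have hp := (hSrange x).1
    have := (hS1 x).log hp.ne'
    rw [hdS, mul_div_assoc, div_self hp.ne', mul_one] at this
    exact this
  have hlogbot := MeasureTheory.tendsto_limUnder_of_hasDerivAt_of_integrableOn_Iic (a := 0)
    (fun x _ => hL x) ((hIint.const_mul (τ / c)).integrableOn)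
  generalize Filter.atBot.limUnder (fun y => Real.log (S y)) = L at hlogbot
  have hSbot : Filter.Tendsto S Filter.atBot (nhds (Real.exp L)) := by
    have := (Real.continuous_exp.tendsto L).comp hlogbot
    refine this.congr (fun x => ?_)
    simp [Real.exp_log (hSrange x).1]
  refine ⟨hmono, ?_, Real.exp L, Real.exp_pos L, ?_, hSbot, ?_⟩
  · intro x
    have := (hSrange x).1
    rw [hdS]
    field_simp
  · exact lt_of_le_of_lt (hmono.monotone.le_of_tendsto hSbot 0) (hSrange 0).2
  have hlogtop : Filter.Tendsto (fun y => Real.log (S y)) Filter.atTop (nhds (Real.log s₀)) :=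
    hSlim.log hs₀.1.ne'
  have hF : ∀ x, HasDerivAt (fun y => -c * I y - c * S y + η * (c / τ) * Real.log (S y))
      (lam * (I (x - 1) - 2 * I x + I (x + 1))) x := by
    intro x
    have := (((hI1 x).const_mul (-c)).sub ((hS1 x).const_mul c)).add
      ((hL x).const_mul (η * (c / τ)))
    refine this.congr_deriv ?_
    rw [hodeI, hdS]
    field_simp
    ring
  have i1 := hIint.comp_sub_right (1 : ℝ)
  have i2 := hIint.comp_add_right (1 : ℝ)
  have i3 := hIint.const_mul (2 : ℝ)
  have i13 : MeasureTheory.Integrable (fun x => I (x - 1) - 2 * I x) := i1.sub i3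
  have hint0 : ∫ x, lam * (I (x - 1) - 2 * I x + I (x + 1)) = 0 := by
    rw [MeasureTheory.integral_const_mul, MeasureTheory.integral_add i13 i2,
      MeasureTheory.integral_sub i1 i3, MeasureTheory.integral_const_mul,
      MeasureTheory.integral_sub_right_eq_self I (1 : ℝ),
      MeasureTheory.integral_add_right_eq_self I (1 : ℝ)]
    ring
  have key := MeasureTheory.integral_of_hasDerivAt_of_tendsto hF
    (((i1.sub i3).add i2).const_mul lam)
    (((hIlimBot.const_mul (-c)).sub (hSbot.const_mul c)).add (hlogbot.const_mul (η * (c / τ))))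
    (((hIlimTop.const_mul (-c)).sub (hSlim.const_mul c)).add (hlogtop.const_mul (η * (c / τ))))
  rw [hint0] at key
  rw [Real.log_exp]
  have h2 : c * ((Real.exp L - η / τ * L) - (s₀ - η / τ * Real.log s₀)) = 0 := by
    linear_combination -key
  have h3 := (mul_eq_zero.mp h2).resolve_left hc.ne'
  linarith
end

section
/- Let k ≥ 2 be an integer, assume 𝓡₀ > 1 and 0 < λ < λ_c := η(𝓡₀ - 1)/(k + 1 - 2√k). Define c_*^k := min_{γ>0} [η(𝓡₀ - 1) + λ(e^{γ} - (k+1) + k e^{-γ})]/γ. Let (𝓘_n(t))_{n≥1} be the solution of the tree equation 𝓘_n'(t) = f(𝓘_n(t)) + λ(𝓘_{n-1}(t) - (k+1)𝓘_n(t) + k𝓘_{n+1}(t)) for n ≥ 2, 𝓘_1'(t) = f(𝓘_1(t)) + i₀ + λ(k+1)(-𝓘_1(t) + 𝓘_2(t)), with 𝓘_n(0) = 0 for all n ≥ 1. Then for every c ∈ (0, c_*^k), lim_{t→+∞} sup_{1 ≤ n ≤ ct} |𝓘_n(t) - I_n^∞| = 0, where (I_n^∞)_{n≥1} is the unique positive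 bounded solution of the corresponding stationary equation. -/
/-- The nonlinearity `f(v) = s₀(1 - e^{-τ v}) - η v`. -/
noncomputable def fSIR (τ η s₀ v : ℝ) : ℝ := s₀ * (1 - Real.exp (-τ * v)) - η * v

/-- `(I_n)_{n ≥ 1}` is a positive bounded solution of the stationary tree equation
`0 = f(I_n) + λ(I_{n-1} - (k+1) I_n + k I_{n+1})` for `n ≥ 2`, together with
`0 = f(I_1) + i₀ + λ(k+1)(-I_1 + I_2)` at the root. -/
def TreeStationary (τ η lam s₀ i₀ : ℝ) (k : ℕ) (I : ℕ → ℝ) : Prop :=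
  (∀ n : ℕ, 1 ≤ n → 0 < I n) ∧ (∃ M : ℝ, ∀ n : ℕ, 1 ≤ n → I n ≤ M) ∧
  (∀ n : ℕ, 2 ≤ n →
    0 = fSIR τ η s₀ (I n)
        + lam * (I (n - 1) - ((k : ℝ) + 1) * I n + (k : ℝ) * I (n + 1))) ∧
  (0 = fSIR τ η s₀ (I 1) + i₀ + lam * ((k : ℝ) + 1) * (-I 1 + I 2))


open Set Filter Topology

lemma aux_touch (T C M : ℝ) (hC : 0 ≤ C) (w : ℕ → ℝ → ℝ)
    (hc : ∀ n, 1 ≤ n → ContinuousOn (w n) (Icc 0 T))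
    (h0 : ∀ n, 1 ≤ n → w n 0 ≤ 0)
    (hM : ∀ n, 1 ≤ n → ∀ t ∈ Icc 0 T, w n t ≤ M)
    (key : ∀ n, 1 ≤ n → ∀ t, 0 < t → t ≤ T → 0 < w n t → ∃ d, HasDerivAt (w n) d t ∧
      ∀ Z, 0 < Z → (∀ m, 1 ≤ m → m ≤ n + 1 → n ≤ m + 1 → w m t ≤ Z) → d ≤ C * Z) :
    ∀ n, 1 ≤ n → ∀ t ∈ Icc 0 T, w n t ≤ 0 := by
  set K := 2 * C + 1 with hK
  suffices H : ∀ ρ : ℝ, 0 < ρ → ∀ n : ℕ, 1 ≤ n → ∀ t ∈ Icc 0 T,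
      w n t < ρ * ((n + 1) * Real.exp (K * t)) by
    intro n hn t ht
    by_contra hcon
    push Not at hcon
    have hp : 0 < ((n : ℝ) + 1) * Real.exp (K * t) := by positivity
    have := H (w n t / (((n : ℝ) + 1) * Real.exp (K * t))) (by positivity) n hn t ht
    rw [div_mul_cancel₀ _ hp.ne'] at this
    exact lt_irrefl _ this
  intro ρ hρ n0 hn0 t0 ht0
  by_contra hcon
  push Not at hcon
  set z : ℕ → ℝ → ℝ := fun n t => ρ * ((n + 1) * Real.exp (K * t)) with hz
  have hzpos : ∀ n t, 0 < z n t := fun n t => by simp only [hz]; positivity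
  have hzc : ∀ n, Continuous (z n) := fun n => by simp only [hz]; fun_prop
  obtain ⟨N, hN⟩ := exists_nat_gt (M / ρ)
  have hbig : ∀ n : ℕ, 1 ≤ n → N ≤ n → ∀ t ∈ Icc 0 T, w n t < z n t := by
    intro n hn hNn t ht
    have h1 := hM n hn t ht
    have h2 : M < ρ * N := by rw [div_lt_iff₀ hρ] at hN; linarith
    have h3 : (N : ℝ) ≤ n := by exact_mod_cast hNn
    have h4 : 1 ≤ Real.exp (K * t) := Real.one_le_exp (by have := ht.1; positivity)
    have h5 : ((n : ℝ)) ≤ (n + 1) * Real.exp (K * t) := by nlinarith [Nat.cast_nonneg (α := ℝ) n]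
    have h6 : ρ * N ≤ ρ * ((n + 1) * Real.exp (K * t)) := by gcongr; linarith
    simp only [hz]; linarith
  set S : Set ℝ := ⋃ n ∈ Finset.Icc 1 N, {t | t ∈ Icc 0 T ∧ w n t - z n t ∈ Ici (0 : ℝ)} with hS
  have hScl : IsClosed S := by
    apply Set.Finite.isClosed_biUnion (Finset.finite_toSet _)
    intro n hn
    have hn1 : 1 ≤ n := (Finset.mem_Icc.1 hn).1
    exact ((hc n hn1).sub (hzc n).continuousOn).preimage_isClosed_of_isClosed isClosed_Icc isClosed_Ici
  have hSsub : S ⊆ Icc 0 T := by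
    intro t ht
    simp only [hS, mem_iUnion] at ht
    obtain ⟨n, hn, h1, h2⟩ := ht
    exact h1
  have hmem : ∀ n, 1 ≤ n → ∀ t ∈ Icc 0 T, z n t ≤ w n t → t ∈ S := by
    intro n hn t ht hle
    simp only [hS, mem_iUnion]
    refine ⟨n, Finset.mem_Icc.2 ⟨hn, ?_⟩, ht, ?_⟩
    · by_contra hlt
      push Not at hlt
      exact absurd (hbig n hn hlt.le t ht) (not_lt.2 hle)
    · simpa using hle
  have hScomp : IsCompact S := isCompact_Icc.of_isClosed_subset hScl hSsub
  obtain ⟨ts, hts, hmin⟩ := hScomp.exists_isLeast ⟨t0, hmem n0 hn0 t0 ht0 hcon⟩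
  have htsI := hSsub hts
  have hex := hts
  simp only [hS, mem_iUnion] at hex
  obtain ⟨n, hn, -, hge⟩ := hex
  have hn1 : 1 ≤ n := (Finset.mem_Icc.1 hn).1
  have hge' : z n ts ≤ w n ts := by simpa using hge
  have hpos : 0 < ts := by
    rcases htsI.1.lt_or_eq with h | h
    · exact h
    · exfalso
      rw [← h] at hge'
      linarith [h0 n hn1, hzpos n 0]
  have hbef : ∀ m, 1 ≤ m → ∀ s ∈ Ico 0 ts, w m s < z m s := by
    intro m hm s hs
    by_contra hle
    push Not at hle
    exact absurd (hmin (hmem m hm s ⟨hs.1, hs.2.le.trans htsI.2⟩ hle)) (not_le.2 hs.2)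
  have hat : ∀ m, 1 ≤ m → w m ts ≤ z m ts := by
    intro m hm
    have hcl : ts ∈ closure (Ico 0 ts) := by
      rw [closure_Ico hpos.ne]; exact ⟨hpos.le, le_rfl⟩
    refine ContinuousWithinAt.closure_le hcl ?_ (hzc m).continuousWithinAt (fun s hs => (hbef m hm s hs).le)
    exact (hc m hm ts htsI).mono (fun s hs => ⟨hs.1, hs.2.le.trans htsI.2⟩)
  obtain ⟨d, hd, hdZ⟩ := key n hn1 ts hpos htsI.2 (lt_of_lt_of_le (hzpos _ _) hge')
  have hd2 := hdZ (2 * z n ts) (by linarith [hzpos n ts]) (by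
    intro m hm h1 h2
    refine (hat m hm).trans ?_
    simp only [hz]
    have : (m : ℝ) ≤ n + 1 := by exact_mod_cast h1
    have h3 : ((m : ℝ) + 1) ≤ 2 * (n + 1) := by linarith [Nat.cast_nonneg (α := ℝ) n]
    calc ρ * ((m + 1) * Real.exp (K * ts)) ≤ ρ * ((2 * (n + 1)) * Real.exp (K * ts)) := by gcongr
      _ = _ := by ring)
  have hzd : HasDerivAt (z n) (K * z n ts) ts := by
    have h1 : HasDerivAt (fun t : ℝ => Real.exp (K * t)) (Real.exp (K * ts) * (K * 1)) ts :=
      ((hasDerivAt_id ts).const_mul K).exp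
    have h2 := (h1.const_mul ((n : ℝ) + 1)).const_mul ρ
    refine HasDerivAt.congr_deriv h2 ?_
    show _ = K * (ρ * ((n + 1) * Real.exp (K * ts)))
    ring
  have hg := hd.sub hzd
  have hneg : 0 ≤ d - K * z n ts := by
    rw [hasDerivAt_iff_tendsto_slope] at hg
    have hg' := hg.mono_left (nhdsWithin_mono ts (show Iio ts ⊆ {ts}ᶜ from fun s hs => ne_of_lt hs))
    refine ge_of_tendsto hg' ?_
    have : Ioo 0 ts ∈ 𝓝[<] ts := Ioo_mem_nhdsLT hpos
    filter_upwards [this] with s hs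
    rw [slope_def_field]
    apply div_nonneg_of_nonpos
    · have := hbef n hn1 s ⟨hs.1.le, hs.2⟩
      simp only [Pi.sub_apply]; linarith
    · linarith [hs.2]
  have := hzpos n ts
  nlinarith

/-- right-hand side -/
noncomputable def aux_rhs (τ η lam s₀ i₀ : ℝ) (k : ℕ) (u : ℕ → ℝ) (n : ℕ) : ℝ :=
  if n = 1 then fSIR τ η s₀ (u 1) + i₀ + lam * ((k : ℝ) + 1) * (-u 1 + u 2)
  else fSIR τ η s₀ (u n) + lam * (u (n - 1) - ((k : ℝ) + 1) * u n + (k : ℝ) * u (n + 1))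

lemma aux_lip (τ η s₀ M a b : ℝ) (hτ : 0 < τ) (hη : 0 < η) (hs : 0 < s₀) (hb : -M ≤ b)
    (hab : b ≤ a) : fSIR τ η s₀ a - fSIR τ η s₀ b ≤ s₀ * τ * Real.exp (τ * M) * (a - b) := by
  unfold fSIR
  have h1 : Real.exp (-τ * a) = Real.exp (-τ * b) * Real.exp (-τ * (a - b)) := by
    rw [← Real.exp_add]; ring_nf
  have h2 := Real.add_one_le_exp (-τ * (a - b))
  have h3 : Real.exp (-τ * b) ≤ Real.exp (τ * M) := Real.exp_le_exp.2 (by nlinarith)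
  have h4 : 0 ≤ τ * (a - b) := mul_nonneg hτ.le (by linarith)
  have h5 : Real.exp (-τ * b) * (1 - Real.exp (-τ * (a - b))) ≤ Real.exp (τ * M) * (τ * (a - b)) := by
    calc _ ≤ Real.exp (-τ * b) * (τ * (a - b)) := by
          apply mul_le_mul_of_nonneg_left _ (Real.exp_pos _).le; linarith
      _ ≤ _ := by gcongr
  have h6 := mul_le_mul_of_nonneg_left h5 hs.le
  have h7 : 0 ≤ η * (a - b) := mul_nonneg hη.le (by linarith)
  rw [h1]; nlinarith

lemma aux_cmp (τ η lam s₀ i₀ : ℝ) (k : ℕ) (hτ : 0 < τ) (hη : 0 < η) (hlam : 0 < lam)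
    (hs : 0 < s₀) (T M : ℝ) (U V : ℕ → ℝ → ℝ)
    (hUc : ∀ n, 1 ≤ n → ContinuousOn (U n) (Icc 0 T))
    (hVc : ∀ n, 1 ≤ n → ContinuousOn (V n) (Icc 0 T))
    (hUM : ∀ n, 1 ≤ n → ∀ t ∈ Icc 0 T, U n t ≤ M)
    (hVM : ∀ n, 1 ≤ n → ∀ t ∈ Icc 0 T, -M ≤ V n t)
    (h0 : ∀ n, 1 ≤ n → U n 0 ≤ V n 0)
    (hV : ∀ n, 1 ≤ n → ∀ t, 0 < t → t ≤ T → ∃ d, HasDerivAt (V n) d t ∧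
      aux_rhs τ η lam s₀ i₀ k (fun m => V m t) n ≤ d)
    (hU : ∀ n, 1 ≤ n → ∀ t, 0 < t → t ≤ T → V n t < U n t → ∃ d, HasDerivAt (U n) d t ∧
      d ≤ aux_rhs τ η lam s₀ i₀ k (fun m => U m t) n) :
    ∀ n, 1 ≤ n → ∀ t ∈ Icc 0 T, U n t ≤ V n t := by
  have := aux_touch T (s₀ * τ * Real.exp (τ * M) + lam * (k + 1)) (2 * M) (by positivity)
    (fun n t => U n t - V n t) (fun n hn => (hUc n hn).sub (hVc n hn))
    (fun n hn => by linarith [h0 n hn])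
    (fun n hn t ht => by linarith [hUM n hn t ht, hVM n hn t ht]) ?_
  · intro n hn t ht
    linarith [this n hn t ht]
  intro n hn t ht htT hpos
  have hlt : V n t < U n t := by linarith
  obtain ⟨d1, hd1, hr1⟩ := hU n hn t ht htT hlt
  obtain ⟨d2, hd2, hr2⟩ := hV n hn t ht htT
  refine ⟨d1 - d2, hd1.sub hd2, ?_⟩
  intro Z hZ hnb
  have hl := aux_lip τ η s₀ M (U n t) (V n t) hτ hη hs (hVM n hn t ⟨ht.le, htT⟩) hlt.le
  have hself := hnb n hn (by omega) (by omega)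
  have hL : s₀ * τ * Real.exp (τ * M) * (U n t - V n t) ≤ s₀ * τ * Real.exp (τ * M) * Z := by
    gcongr
  have hnext := hnb (n + 1) (by omega) (by omega) (by omega)
  have hk0 : (0 : ℝ) ≤ k := Nat.cast_nonneg k
  unfold aux_rhs at hr1 hr2
  by_cases h1 : n = 1
  · subst h1
    simp only [if_true] at hr1 hr2
    have e : lam * ((k : ℝ) + 1) * ((U 2 t - V 2 t) - (U 1 t - V 1 t)) ≤ lam * (k + 1) * Z := by
      apply mul_le_mul_of_nonneg_left _ (by positivity)
      norm_num at hnext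
      linarith
    nlinarith
  · simp only [h1, if_false] at hr1 hr2
    have hprev := hnb (n - 1) (by omega) (by omega) (by omega)
    have e : lam * ((U (n - 1) t - V (n - 1) t) - (k + 1) * (U n t - V n t)
        + k * (U (n + 1) t - V (n + 1) t)) ≤ lam * ((k + 1) * Z) := by
      apply mul_le_mul_of_nonneg_left _ hlam.le
      have := mul_le_mul_of_nonneg_left hnext hk0
      have h3 : 0 ≤ (k + 1) * (U n t - V n t) := by positivity
      linarith
    nlinarith

lemma aux_exp_upper (x : ℝ) (hx : 0 ≤ x) : Real.exp (-x) ≤ 1 - x + x ^ 2 / 2 := by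
  have h1 := Real.quadratic_le_exp_of_nonneg hx
  have h2 : Real.exp (-x) * Real.exp x = 1 := by rw [← Real.exp_add]; simp
  have h3 := Real.exp_pos (-x)
  have h4 : 0 < 1 - x + x ^ 2 / 2 := by nlinarith [sq_nonneg (x - 1)]
  have h5 : 1 ≤ (1 - x + x ^ 2 / 2) * Real.exp x := by
    have := mul_le_mul_of_nonneg_left h1 h4.le
    nlinarith [sq_nonneg (x ^ 2)]
  nlinarith [Real.exp_pos x]

lemma aux_f_lower (τ η s₀ e u : ℝ) (hτ : 0 < τ) (hs : 0 < s₀) (hu : 0 ≤ u)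
    (hue : s₀ * τ ^ 2 * u ≤ 2 * e) : (s₀ * τ - η - e) * u ≤ fSIR τ η s₀ u := by
  unfold fSIR
  have h := aux_exp_upper (τ * u) (by positivity)
  have h2 : s₀ * τ ^ 2 * u * u ≤ 2 * e * u := by gcongr
  have h3 := mul_le_mul_of_nonneg_left h hs.le
  rw [neg_mul]
  nlinarith

lemma aux_f_conc (τ η s₀ θ0 θ δ M E : ℝ) (hτ : 0 < τ) (hs : 0 < s₀) (h0 : 0 < θ0)
    (h1 : θ0 ≤ θ) (h2 : θ ≤ 1) (hδ : 0 < δ) (hE : δ ≤ E) (hM : E ≤ M) :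
    θ * fSIR τ η s₀ E + (s₀ * Real.exp (-τ * M) * θ0 ^ 2 * τ ^ 2 * δ / 2) * (1 - θ) * E
      ≤ fSIR τ η s₀ (θ * E) := by
  have hE0 : 0 < E := by linarith
  have hθ : 0 < θ := by linarith
  set y := τ * E with hy
  have hy0 : 0 < y := by positivity
  have a1 := Real.quadratic_le_exp_of_nonneg (show 0 ≤ θ * y by positivity)
  have a2 := Real.add_one_le_exp (-(1 - θ) * y)
  have a3 : (1 - θ) * (θ ^ 2 * y ^ 2 / 2) ≤ (1 - θ) * Real.exp (θ * y) + θ * Real.exp (-(1 - θ) * y) - 1 := by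
    have := mul_le_mul_of_nonneg_left a1 (show 0 ≤ 1 - θ by linarith)
    have := mul_le_mul_of_nonneg_left a2 hθ.le
    nlinarith
  have a4 := mul_le_mul_of_nonneg_left a3 (Real.exp_pos (-(θ * y))).le
  have e1 : Real.exp (-(θ * y)) * Real.exp (θ * y) = 1 := by rw [← Real.exp_add]; simp
  have e2 : Real.exp (-(θ * y)) * Real.exp (-(1 - θ) * y) = Real.exp (-y) := by
    rw [← Real.exp_add]; ring_nf
  have a5 : Real.exp (-(θ * y)) * ((1 - θ) * (θ ^ 2 * y ^ 2 / 2)) ≤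
      1 - θ + θ * Real.exp (-y) - Real.exp (-(θ * y)) := by
    calc _ ≤ _ := a4
      _ = (1 - θ) * (Real.exp (-(θ * y)) * Real.exp (θ * y)) + θ * (Real.exp (-(θ * y)) * Real.exp (-(1 - θ) * y)) - Real.exp (-(θ * y)) := by ring
      _ = _ := by rw [e1, e2]; ring
  have b1 : Real.exp (-τ * M) ≤ Real.exp (-(θ * y)) := by
    apply Real.exp_le_exp.2
    have : θ * y ≤ y := by nlinarith
    have : y ≤ τ * M := by rw [hy]; gcongr
    linarith
  have b2 : Real.exp (-τ * M) * ((1 - θ) * (θ0 ^ 2 * (τ ^ 2 * (δ * E)) / 2)) ≤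
      Real.exp (-(θ * y)) * ((1 - θ) * (θ ^ 2 * y ^ 2 / 2)) := by
    have c1 : (0 : ℝ) ≤ 1 - θ := by linarith
    have c2 : δ * E ≤ E ^ 2 := by nlinarith
    have c3 : y ^ 2 = τ ^ 2 * E ^ 2 := by rw [hy]; ring
    rw [c3]
    gcongr
  have b3 := mul_le_mul_of_nonneg_left (b2.trans a5) hs.le
  unfold fSIR
  have f1 : -τ * (θ * E) = -(θ * y) := by rw [hy]; ring
  have f2 : -τ * E = -y := by rw [hy]; ring
  rw [f1, f2]
  nlinarith

lemma aux_speed (τ η lam s₀ : ℝ) (hlam : 0 < lam)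
    (k : ℕ) (hk : 2 ≤ k) (cs c : ℝ) (hc : 0 < c) (hcs : c < cs)
    (h : ∀ γ : ℝ, 0 < γ → cs ≤ ((s₀ * τ - η)
          + lam * (Real.exp γ - ((k : ℝ) + 1) + (k : ℝ) * Real.exp (-γ))) / γ) :
    ∃ α ω c2 e : ℝ, 0 < α ∧ 0 < ω ∧ ω < 1 ∧ c < c2 ∧ 0 < e ∧
      lam * (Real.exp α - k * Real.exp (-α)) * Real.sin ω = c2 * ω ∧
      c2 * α ≤ s₀ * τ - η - e
        + lam * ((Real.exp α + k * Real.exp (-α)) * Real.cos ω - (k + 1)) := by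
  have hk' : (2 : ℝ) ≤ k := by exact_mod_cast hk
  set c1 := (c + cs) / 2 with hc1
  have hcc1 : c < c1 := by rw [hc1]; linarith
  have hc1s : c1 < cs := by rw [hc1]; linarith
  set q := c1 / lam with hq
  have hq0 : 0 < q := by rw [hq]; apply div_pos _ hlam; linarith
  set a := (q + Real.sqrt (q ^ 2 + 4 * k)) / 2 with ha
  have hsq : Real.sqrt (q ^ 2 + 4 * k) ^ 2 = q ^ 2 + 4 * k := Real.sq_sqrt (by positivity)
  have hsn := Real.sqrt_nonneg (q ^ 2 + 4 * k)
  have ha2 : a ^ 2 = q * a + k := by rw [ha]; nlinarith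
  have ha0 : 0 < a := by rw [ha]; linarith
  have ha1 : 1 < a := by
    by_contra hcon
    push Not at hcon
    nlinarith [mul_pos hq0 ha0]
  set α := Real.log a with hα
  have hα0 : 0 < α := Real.log_pos ha1
  have hea : Real.exp α = a := Real.exp_log ha0
  have hea' : Real.exp (-α) = a⁻¹ := by rw [Real.exp_neg, hea]
  have hd : lam * (Real.exp α - k * Real.exp (-α)) = c1 := by
    rw [hea, hea']
    have : a - k * a⁻¹ = q := by field_simp; linarith
    rw [this, hq]; field_simp
  have hD := h α hα0
  rw [le_div_iff₀ hα0] at hD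
  set D := (s₀ * τ - η) + lam * (Real.exp α - ((k : ℝ) + 1) + (k : ℝ) * Real.exp (-α)) - c1 * α with hDd
  have hDpos : 0 < D := by
    have : c1 * α < cs * α := by gcongr
    rw [hDd]; linarith
  have t1 : Tendsto (fun ω : ℝ => c1 * (ω⁻¹ * Real.sin ω)) (𝓝[>] 0) (𝓝 (c1 * 1)) := by
    have hs := Real.hasDerivAt_sin 0
    rw [hasDerivAt_iff_tendsto_slope, Real.cos_zero] at hs
    have hs' := hs.mono_left (nhdsWithin_mono (0 : ℝ) (show Ioi (0 : ℝ) ⊆ {0}ᶜ from fun s hs => ne_of_gt hs))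
    refine (hs'.congr ?_).const_mul c1
    intro x
    rw [slope_def_field]
    simp [div_eq_inv_mul]
  have t2 : Tendsto (fun ω : ℝ => (s₀ * τ - η) + lam * ((Real.exp α + k * Real.exp (-α)) * Real.cos ω - (k + 1)) - c1 * α) (𝓝[>] 0)
      (𝓝 ((s₀ * τ - η) + lam * ((Real.exp α + k * Real.exp (-α)) * Real.cos 0 - (k + 1)) - c1 * α)) := by
    apply tendsto_nhdsWithin_of_tendsto_nhds
    apply Continuous.tendsto
    fun_prop
  have e1 := t1.eventually_const_lt (show c < c1 * 1 by linarith)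
  have e2 := t2.eventually_const_lt (show D / 2 < _ by
    rw [Real.cos_zero]
    have : (s₀ * τ - η) + lam * ((Real.exp α + k * Real.exp (-α)) * 1 - (k + 1)) - c1 * α = D := by
      rw [hDd]; ring
    rw [this]; linarith)
  have e3 : Ioo (0 : ℝ) 1 ∈ 𝓝[>] (0 : ℝ) := Ioo_mem_nhdsGT one_pos
  obtain ⟨ω, h1, h2, h3⟩ := (e1.and (e2.and e3)).exists
  have hω : 0 < ω := h3.1
  refine ⟨α, ω, c1 * (ω⁻¹ * Real.sin ω), D / 2, hα0, h3.1, h3.2, h1, by linarith, ?_, ?_⟩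
  · rw [hd]; field_simp
  · have : c1 * (ω⁻¹ * Real.sin ω) ≤ c1 := by
      have h5 : ω⁻¹ * Real.sin ω ≤ 1 := by
        rw [inv_mul_le_iff₀ hω]; simpa using Real.sin_le hω.le
      nlinarith
    have := mul_le_mul_of_nonneg_right this hα0.le
    linarith

lemma aux_shift_deriv (g : ℝ → ℝ) (d h t : ℝ) (hg : HasDerivAt g d (h + t)) :
    HasDerivAt (fun s => g (h + s)) d t := by
  have := HasDerivAt.comp_const_add h t hg
  exact this

lemma aux_shift_cont (g : ℝ → ℝ) (h T : ℝ) (hh : 0 ≤ h) (hg : ContinuousOn g (Ici 0)) :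
    ContinuousOn (fun s => g (h + s)) (Icc 0 T) := by
  refine hg.comp (by fun_prop) ?_
  intro s hs
  have := hs.1
  simp only [mem_Ici]; linarith

lemma aux_nonneg (τ η lam s₀ i₀ : ℝ) (k : ℕ) (hτ : 0 < τ) (hη : 0 < η) (hlam : 0 < lam)
    (hs : 0 < s₀) (hi : 0 < i₀) (J : ℕ → ℝ → ℝ)
    (hcont : ∀ n : ℕ, 1 ≤ n → ContinuousOn (J n) (Ici (0 : ℝ)))
    (hode : ∀ n : ℕ, 1 ≤ n → ∀ t : ℝ, 0 < t →
      HasDerivAt (J n) (aux_rhs τ η lam s₀ i₀ k (fun m => J m t) n) t)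
    (hbdd : ∀ T : ℝ, 0 < T → ∃ M : ℝ, ∀ n : ℕ, 1 ≤ n → ∀ t ∈ Icc (0 : ℝ) T, |J n t| ≤ M)
    (hinit : ∀ n : ℕ, 1 ≤ n → J n 0 = 0) :
    ∀ n, 1 ≤ n → ∀ t, 0 ≤ t → 0 ≤ J n t := by
  intro n hn t ht
  obtain ⟨M, hM⟩ := hbdd (t + 1) (by linarith)
  have hM0 : 0 ≤ M := (abs_nonneg _).trans (hM 1 le_rfl 0 ⟨le_rfl, by linarith⟩)
  refine aux_cmp τ η lam s₀ i₀ k hτ hη hlam hs (t + 1) M (fun _ _ => 0) J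
    (fun n _ => continuousOn_const) (fun n hn => (hcont n hn).mono (fun s hs => hs.1))
    (fun _ _ _ _ => hM0) (fun n hn s hs => (abs_le.1 (hM n hn s hs)).1)
    (fun n hn => (hinit n hn).ge) (fun n hn s hs _ => ⟨_, hode n hn s hs, le_rfl⟩)
    ?_ n hn t ⟨ht, by linarith⟩
  intro m hm s hs1 _ _
  refine ⟨0, hasDerivAt_const _ _, ?_⟩
  unfold aux_rhs fSIR
  split_ifs <;> simp [hi.le]

lemma aux_le (τ η lam s₀ i₀ : ℝ) (k : ℕ) (hτ : 0 < τ) (hη : 0 < η) (hlam : 0 < lam)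
    (hs : 0 < s₀) (J : ℕ → ℝ → ℝ)
    (hcont : ∀ n : ℕ, 1 ≤ n → ContinuousOn (J n) (Ici (0 : ℝ)))
    (hode : ∀ n : ℕ, 1 ≤ n → ∀ t : ℝ, 0 < t →
      HasDerivAt (J n) (aux_rhs τ η lam s₀ i₀ k (fun m => J m t) n) t)
    (hbdd : ∀ T : ℝ, 0 < T → ∃ M : ℝ, ∀ n : ℕ, 1 ≤ n → ∀ t ∈ Icc (0 : ℝ) T, |J n t| ≤ M)
    (hinit : ∀ n : ℕ, 1 ≤ n → J n 0 = 0)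
    (E : ℕ → ℝ) (hE : ∀ n, 1 ≤ n → 0 < E n)
    (hEr : ∀ n, 1 ≤ n → aux_rhs τ η lam s₀ i₀ k E n = 0) :
    ∀ n, 1 ≤ n → ∀ t, 0 ≤ t → J n t ≤ E n := by
  intro n hn t ht
  obtain ⟨M, hM⟩ := hbdd (t + 1) (by linarith)
  have hM0 : 0 ≤ M := (abs_nonneg _).trans (hM 1 le_rfl 0 ⟨le_rfl, by linarith⟩)
  exact aux_cmp τ η lam s₀ i₀ k hτ hη hlam hs (t + 1) M J (fun n _ => E n)
    (fun n hn => (hcont n hn).mono (fun s hs => hs.1)) (fun n _ => continuousOn_const)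
    (fun n hn s hs => (abs_le.1 (hM n hn s hs)).2)
    (fun n hn s _ => by linarith [hE n hn])
    (fun n hn => by rw [hinit n hn]; exact (hE n hn).le)
    (fun n hn s _ _ => ⟨0, hasDerivAt_const _ _, (hEr n hn).le⟩)
    (fun n hn s hs _ _ => ⟨_, hode n hn s hs, le_rfl⟩) n hn t ⟨ht, by linarith⟩

lemma aux_mono (τ η lam s₀ i₀ : ℝ) (k : ℕ) (hτ : 0 < τ) (hη : 0 < η) (hlam : 0 < lam)
    (hs : 0 < s₀) (hi : 0 < i₀) (J : ℕ → ℝ → ℝ)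
    (hcont : ∀ n : ℕ, 1 ≤ n → ContinuousOn (J n) (Ici (0 : ℝ)))
    (hode : ∀ n : ℕ, 1 ≤ n → ∀ t : ℝ, 0 < t →
      HasDerivAt (J n) (aux_rhs τ η lam s₀ i₀ k (fun m => J m t) n) t)
    (hbdd : ∀ T : ℝ, 0 < T → ∃ M : ℝ, ∀ n : ℕ, 1 ≤ n → ∀ t ∈ Icc (0 : ℝ) T, |J n t| ≤ M)
    (hinit : ∀ n : ℕ, 1 ≤ n → J n 0 = 0) :
    ∀ n, 1 ≤ n → ∀ s t, 0 ≤ s → s ≤ t → J n s ≤ J n t := by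
  have hnn := aux_nonneg τ η lam s₀ i₀ k hτ hη hlam hs hi J hcont hode hbdd hinit
  intro n hn s t hs0 hst
  obtain ⟨M, hM⟩ := hbdd (t + 1) (by linarith)
  have hM0 : 0 ≤ M := (abs_nonneg _).trans (hM 1 le_rfl 0 ⟨le_rfl, by linarith⟩)
  have := aux_cmp τ η lam s₀ i₀ k hτ hη hlam hs s M J (fun n r => J n ((t - s) + r))
    (fun n hn => (hcont n hn).mono (fun s hs => hs.1))
    (fun n hn => aux_shift_cont _ _ _ (by linarith) (hcont n hn))
    (fun n hn r hr => (abs_le.1 (hM n hn r ⟨hr.1, by linarith [hr.2]⟩)).2)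
    (fun n hn r hr => by linarith [hnn n hn (t - s + r) (by linarith [hr.1])])
    (fun n hn => by rw [hinit n hn]; exact hnn n hn _ (by linarith))
    (fun n hn r hr _ => ⟨_, aux_shift_deriv _ _ _ _ (hode n hn (t - s + r) (by linarith)), le_rfl⟩)
    (fun n hn r hr _ _ => ⟨_, hode n hn r hr, le_rfl⟩) n hn s ⟨hs0, le_rfl⟩
  simpa using this

lemma aux_pos (τ η lam s₀ i₀ : ℝ) (k : ℕ) (hlam : 0 < lam)
    (hi : 0 < i₀) (J : ℕ → ℝ → ℝ)
    (hode : ∀ n : ℕ, 1 ≤ n → ∀ t : ℝ, 0 < t →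
      HasDerivAt (J n) (aux_rhs τ η lam s₀ i₀ k (fun m => J m t) n) t)
    (hnn : ∀ n, 1 ≤ n → ∀ t, 0 ≤ t → 0 ≤ J n t) (t : ℝ) (ht : 0 < t) :
    ∀ n, 1 ≤ n → 0 < J n t := by
  have key : ∀ n, 1 ≤ n → J n t = 0 → aux_rhs τ η lam s₀ i₀ k (fun m => J m t) n = 0 := by
    intro n hn h0
    have hmin : IsLocalMin (J n) t := by
      filter_upwards [Ioi_mem_nhds ht] with s hs
      rw [h0]
      exact hnn n hn s (le_of_lt hs)
    exact hmin.hasDerivAt_eq_zero (hode n hn t ht)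
  intro n hn
  induction n, hn using Nat.le_induction with
  | base =>
    rcases (hnn 1 le_rfl t ht.le).lt_or_eq with h | h
    · exact h
    · exfalso
      have h1 := key 1 le_rfl h.symm
      have h2 := hnn 2 (by norm_num) t ht.le
      simp only [aux_rhs, if_true, ← h, fSIR] at h1
      have : 0 ≤ lam * ((k : ℝ) + 1) * (-0 + J 2 t) := by rw [neg_zero, zero_add]; positivity
      simp at h1 this
      linarith
  | succ n hn ih =>
    rcases (hnn (n + 1) (by omega) t ht.le).lt_or_eq with h | h
    · exact h
    · exfalso
      have h1 := key (n + 1) (by omega) h.symm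
      have h2 := hnn (n + 1 + 1) (by omega) t ht.le
      have hne : n + 1 ≠ 1 := by omega
      simp only [aux_rhs, hne, if_false, ← h, fSIR, Nat.add_sub_cancel] at h1
      have h3 : 0 ≤ (k : ℝ) * J (n + 1 + 1) t := by positivity
      have h4 : 0 < lam * (J n t + k * J (n + 1 + 1) t) := by
        apply mul_pos hlam; linarith
      simp at h1
      rcases h1 with h1 | h1 <;> linarith

lemma aux_spread (τ η lam s₀ i₀ : ℝ) (k : ℕ) (hτ : 0 < τ) (hη : 0 < η) (hlam : 0 < lam)
    (hs : 0 < s₀) (J : ℕ → ℝ → ℝ)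
    (hcont : ∀ n : ℕ, 1 ≤ n → ContinuousOn (J n) (Ici (0 : ℝ)))
    (hode : ∀ n : ℕ, 1 ≤ n → ∀ t : ℝ, 0 < t →
      HasDerivAt (J n) (aux_rhs τ η lam s₀ i₀ k (fun m => J m t) n) t)
    (hnn : ∀ n, 1 ≤ n → ∀ t, 0 ≤ t → 0 ≤ J n t)
    (hmono : ∀ n, 1 ≤ n → ∀ s t, 0 ≤ s → s ≤ t → J n s ≤ J n t)
    (hpos : ∀ n, 1 ≤ n → 0 < J n 1)
    (α ω c e : ℝ) (hα : 0 < α) (hω : 0 < ω) (hω1 : ω < 1) (hc : 0 < c) (he : 0 < e)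
    (hsin : lam * (Real.exp α - k * Real.exp (-α)) * Real.sin ω = c * ω)
    (hD : c * α ≤ s₀ * τ - η - e
        + lam * ((Real.exp α + k * Real.exp (-α)) * Real.cos ω - (k + 1))) :
    ∃ δ, 0 < δ ∧ ∀ n : ℕ, 1 ≤ n → ∀ t, 1 ≤ t → (n : ℝ) ≤ c * (t - 1) → δ ≤ J n t := by
  set R := Real.pi / (2 * ω) with hR
  have hR0 : 0 < R := by rw [hR]; positivity
  have hRω : ω * R = Real.pi / 2 := by rw [hR]; field_simp
  set X := R + 2 with hX
  obtain ⟨N, hN⟩ := exists_nat_gt (X + R)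
  obtain ⟨j, hj0, hj⟩ : ∃ j, 0 < j ∧ ∀ n, 1 ≤ n → n ≤ N → j ≤ J n 1 := by
    have hne : (Finset.Icc 1 (N + 1)).Nonempty := ⟨1, by simp⟩
    obtain ⟨m, hm, hmin⟩ := Finset.exists_min_image _ (fun n => J n 1) hne
    refine ⟨J m 1, hpos m (Finset.mem_Icc.1 hm).1, fun n h1 h2 => hmin n ?_⟩
    exact Finset.mem_Icc.2 ⟨h1, by omega⟩
  set P := Real.exp (α * R) with hP
  have hP0 : 0 < P := Real.exp_pos _
  set ε := min (j / P) (2 * e / (s₀ * τ ^ 2) / P) with hε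
  have hε0 : 0 < ε := by rw [hε]; positivity
  have hε1 : ε * P ≤ j := by
    rw [← le_div_iff₀ hP0]; exact min_le_left _ _
  have hε2 : s₀ * τ ^ 2 * (ε * P) ≤ 2 * e := by
    have : ε * P ≤ 2 * e / (s₀ * τ ^ 2) := by
      rw [← le_div_iff₀ hP0]; exact min_le_right _ _
    rw [le_div_iff₀ (by positivity)] at this
    linarith
  set q : ℝ → ℝ := fun x => Real.cos (min |ω * x| (Real.pi / 2)) with hq
  have hpi := Real.pi_pos
  have hpi3 := Real.pi_gt_three
  have hqin : ∀ x, |ω * x| < Real.pi / 2 → q x = Real.cos (ω * x) := by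
    intro x hx
    simp only [hq]
    rw [min_eq_left hx.le, Real.cos_abs]
  have hqout : ∀ x, Real.pi / 2 ≤ |ω * x| → q x = 0 := by
    intro x hx
    simp only [hq]
    rw [min_eq_right hx, Real.cos_pi_div_two]
  have hqnn : ∀ x, 0 ≤ q x := by
    intro x
    apply Real.cos_nonneg_of_neg_pi_div_two_le_of_le
    · have : 0 ≤ min |ω * x| (Real.pi / 2) := le_min (abs_nonneg _) (by linarith)
      linarith
    · exact min_le_right _ _
  have hqge : ∀ x, |ω * x| ≤ Real.pi / 2 + ω → Real.cos (ω * x) ≤ q x := by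
    intro x hx
    by_cases h : |ω * x| < Real.pi / 2
    · exact (hqin x h).ge
    · push Not at h
      rw [hqout x h, ← Real.cos_abs]
      exact Real.cos_nonpos_of_pi_div_two_le_of_le h (by linarith)
  have hbdq : ∀ x, Real.exp (-α * x) * q x ≤ P := by
    intro x
    by_cases h : |ω * x| < Real.pi / 2
    · have h1 : q x ≤ 1 := Real.cos_le_one _
      have h2 : Real.exp (-α * x) ≤ P := by
        apply Real.exp_le_exp.2
        rw [← hRω] at h
        have := (abs_lt.1 h).1
        have : -R < x := by
          by_contra hh; push Not at hh
          nlinarith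
        nlinarith
      nlinarith [Real.exp_pos (-α * x), hqnn x]
    · push Not at h
      rw [hqout x h, mul_zero]; exact hP0.le
  set U : ℕ → ℝ → ℝ := fun n s =>
    ε * (Real.exp (-α * (n - X - c * s)) * q (n - X - c * s)) with hU
  have hUle : ∀ n s, U n s ≤ ε * P := fun n s => mul_le_mul_of_nonneg_left (hbdq _) hε0.le
  have hUnn : ∀ n s, 0 ≤ U n s := fun n s =>
    mul_nonneg hε0.le (mul_nonneg (Real.exp_pos _).le (hqnn _))
  have hqc : Continuous q := by simp only [hq]; fun_prop
  have hUsupp : ∀ n s, 0 < U n s → |ω * ((n : ℝ) - X - c * s)| < Real.pi / 2 := by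
    intro n s h
    by_contra hh
    push Not at hh
    simp only [hU, hqout _ hh] at h
    simp at h
  have hmain : ∀ T, 0 ≤ T → ∀ n, 1 ≤ n → U n T ≤ J n (1 + T) := by
    intro T hT n hn
    refine aux_cmp τ η lam s₀ i₀ k hτ hη hlam hs T (ε * P) U (fun n s => J n (1 + s))
      ?_ (fun n hn => aux_shift_cont _ _ _ (by linarith) (hcont n hn))
      (fun n _ s _ => hUle n s)
      (fun n hn s hs => ?_) ?_
      (fun n hn r hr _ => ⟨_, aux_shift_deriv _ _ _ _ (hode n hn (1 + r) (by linarith)), le_rfl⟩)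
      ?_ n hn T ⟨hT, le_rfl⟩
    · intro n hn
      apply Continuous.continuousOn
      simp only [hU]
      fun_prop
    · have := hnn n hn (1 + s) (by linarith [hs.1])
      have : 0 < ε * P := by positivity
      linarith
    · intro n hn
      rcases (hUnn n 0).lt_or_eq with h | h
      · have h1 := hUsupp n 0 h
        rw [← hRω] at h1
        have h2 := (abs_lt.1 h1).2
        have h3 : (n : ℝ) - X - c * 0 < R := lt_of_mul_lt_mul_left h2 hω.le
        have h4 : (n : ℝ) < N := by linarith
        have h5 : n ≤ N := by exact_mod_cast h4.le
        simp only [add_zero]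
        exact ((hUle n 0).trans hε1).trans (hj n hn h5)
      · rw [← h]; exact hnn n hn _ (by norm_num)
    · intro n hn s hs0 hsT hlt
      have hUp : 0 < U n s := lt_of_le_of_lt (hnn n hn _ (by linarith)) hlt
      have hsup := hUsupp n s hUp
      set x := (n : ℝ) - X - c * s with hx
      have hxlow : -R < x := by
        rw [← hRω] at hsup
        have := (abs_lt.1 hsup).1
        by_contra hh; push Not at hh
        nlinarith
      have hn2 : 2 < n := by
        have h1 : (2 : ℝ) < n := by
          have : 0 < c * s := by positivity
          rw [hx, hX] at hxlow; linarith
        exact_mod_cast h1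
      have hxd : HasDerivAt (fun r : ℝ => (n : ℝ) - X - c * r) (-c) s := by
        have := ((hasDerivAt_id s).const_mul c).const_sub ((n : ℝ) - X)
        simpa using this
      have hder : HasDerivAt (U n) (ε * (Real.exp (-α * x) * (-α * -c) * Real.cos (ω * x)
          + Real.exp (-α * x) * (-Real.sin (ω * x) * (ω * -c)))) s := by
        have h1 := (((hxd.const_mul (-α)).exp).mul ((hxd.const_mul ω).cos)).const_mul ε
        refine HasDerivAt.congr_of_eventuallyEq h1 ?_
        have hcc : Continuous (fun r : ℝ => |ω * ((n : ℝ) - X - c * r)|) := by fun_prop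
        filter_upwards [hcc.continuousAt.eventually_lt continuousAt_const hsup] with r hr
        simp only [hU, hqin _ hr]
        rfl
      refine ⟨_, hder, ?_⟩
      have hne : n ≠ 1 := by omega
      simp only [aux_rhs, hne, if_false]
      have hf := aux_f_lower τ η s₀ e (U n s) hτ hs hUp.le
        ((mul_le_mul_of_nonneg_left (hUle n s) (by positivity)).trans hε2)
      have hUn : U n s = ε * (Real.exp (-α * x) * Real.cos (ω * x)) := by
        simp only [hU]; rw [← hx, hqin x hsup]
      have hprev : ε * (Real.exp (-α * x) * Real.exp α * (Real.cos (ω * x) * Real.cos ω + Real.sin (ω * x) * Real.sin ω)) ≤ U (n - 1) s := by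
        have e1 : ((n - 1 : ℕ) : ℝ) - X - c * s = x - 1 := by
          rw [Nat.cast_sub hn, hx]; push_cast; ring
        simp only [hU, e1]
        have e2 : Real.exp (-α * x) * Real.exp α = Real.exp (-α * (x - 1)) := by
          rw [← Real.exp_add]; ring_nf
        have e3 : Real.cos (ω * x) * Real.cos ω + Real.sin (ω * x) * Real.sin ω = Real.cos (ω * (x - 1)) := by
          rw [← Real.cos_sub]; ring_nf
        rw [e2, e3]
        have := hqge (x - 1) (by
          have := abs_sub (ω * x) ω
          rw [abs_of_pos hω] at this
          have e4 : ω * (x - 1) = ω * x - ω := by ring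
          rw [e4]; linarith)
        gcongr
      have hnext : ε * (Real.exp (-α * x) * Real.exp (-α) * (Real.cos (ω * x) * Real.cos ω - Real.sin (ω * x) * Real.sin ω)) ≤ U (n + 1) s := by
        have e1 : ((n + 1 : ℕ) : ℝ) - X - c * s = x + 1 := by
          rw [hx]; push_cast; ring
        simp only [hU, e1]
        have e2 : Real.exp (-α * x) * Real.exp (-α) = Real.exp (-α * (x + 1)) := by
          rw [← Real.exp_add]; ring_nf
        have e3 : Real.cos (ω * x) * Real.cos ω - Real.sin (ω * x) * Real.sin ω = Real.cos (ω * (x + 1)) := by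
          rw [← Real.cos_add]; ring_nf
        rw [e2, e3]
        have := hqge (x + 1) (by
          have := abs_add_le (ω * x) ω
          rw [abs_of_pos hω] at this
          have e4 : ω * (x + 1) = ω * x + ω := by ring
          rw [e4]; linarith)
        gcongr
      have hcos : 0 < Real.cos (ω * x) := by
        have := abs_lt.1 hsup
        exact Real.cos_pos_of_mem_Ioo ⟨by linarith, this.2⟩
      have hk0 : (0 : ℝ) ≤ k := Nat.cast_nonneg k
      have g1 : lam * (ε * (Real.exp (-α * x) * Real.exp α * (Real.cos (ω * x) * Real.cos ω + Real.sin (ω * x) * Real.sin ω)) - (k + 1) * U n s + k * (ε * (Real.exp (-α * x) * Real.exp (-α) * (Real.cos (ω * x) * Real.cos ω - Real.sin (ω * x) * Real.sin ω))))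
          ≤ lam * (U (n - 1) s - (k + 1) * U n s + k * U (n + 1) s) := by
        gcongr
      have g2 := mul_le_mul_of_nonneg_left hD (show 0 ≤ ε * (Real.exp (-α * x) * Real.cos (ω * x)) by positivity)
      refine le_trans ?_ (add_le_add hf g1)
      rw [hUn]
      have g3 : ε * Real.exp (-α * x) * Real.sin (ω * x) * (lam * (Real.exp α - k * Real.exp (-α)) * Real.sin ω) = ε * Real.exp (-α * x) * Real.sin (ω * x) * (c * ω) := by rw [hsin]
      nlinarith only [g2, g3]
  refine ⟨min ε j, lt_min hε0 hj0, ?_⟩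
  intro n hn t ht hnt
  by_cases hnX : (n : ℝ) < X
  · have h4 : (n : ℝ) < N := by linarith
    have h5 : n ≤ N := by exact_mod_cast h4.le
    exact (min_le_right _ _).trans ((hj n hn h5).trans (hmono n hn 1 t (by norm_num) ht))
  · push Not at hnX
    have h1 := hmain (((n : ℝ) - X) / c) (div_nonneg (by linarith) hc.le) n hn
    have h2 : U n (((n : ℝ) - X) / c) = ε := by
      have : (n : ℝ) - X - c * (((n : ℝ) - X) / c) = 0 := by field_simp; ring
      simp only [hU, this]
      rw [hqin 0 (by simp; linarith)]
      simp
    have h0 : 0 ≤ ((n : ℝ) - X) / c := div_nonneg (by linarith) hc.le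
    have h3 : 1 + ((n : ℝ) - X) / c ≤ t := by
      have : ((n : ℝ) - X) / c ≤ t - 1 := by
        rw [div_le_iff₀ hc]; nlinarith
      linarith
    rw [h2] at h1
    exact (min_le_left _ _).trans (h1.trans (hmono n hn _ t (by linarith) h3))

lemma aux_final (τ η lam s₀ i₀ : ℝ) (k : ℕ) (hτ : 0 < τ) (hη : 0 < η) (hlam : 0 < lam)
    (hs : 0 < s₀) (hi : 0 < i₀) (J : ℕ → ℝ → ℝ)
    (hcont : ∀ n : ℕ, 1 ≤ n → ContinuousOn (J n) (Ici (0 : ℝ)))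
    (hode : ∀ n : ℕ, 1 ≤ n → ∀ t : ℝ, 0 < t →
      HasDerivAt (J n) (aux_rhs τ η lam s₀ i₀ k (fun m => J m t) n) t)
    (hnn : ∀ n, 1 ≤ n → ∀ t, 0 ≤ t → 0 ≤ J n t)
    (E : ℕ → ℝ) (hEr : ∀ n, 1 ≤ n → aux_rhs τ η lam s₀ i₀ k E n = 0)
    (δ M θ0 r K : ℝ) (hδ : 0 < δ) (hδE : ∀ n, 1 ≤ n → δ ≤ E n) (hEM : ∀ n, 1 ≤ n → E n ≤ M)
    (hθ0 : 0 < θ0) (hθ1 : θ0 ≤ 1) (hθM : θ0 * M ≤ δ)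
    (hr : r = s₀ * Real.exp (-τ * M) * θ0 ^ 2 * τ ^ 2 * δ / 2)
    (hK : K = s₀ * τ + lam * (k + 1) * Real.exp 1)
    (t1 L : ℝ) (ht1 : 0 ≤ t1) (hJ : ∀ n : ℕ, 1 ≤ n → (n : ℝ) ≤ L → δ ≤ J n t1) :
    ∀ T, 0 ≤ T → ∀ n, 1 ≤ n →
      (1 - (1 - θ0) * Real.exp (-r * T)) * E n - M * Real.exp (n - L + K * T) ≤ J n (t1 + T) := by
  have hM0 : 0 < M := hδ.trans_le ((hδE 1 le_rfl).trans (hEM 1 le_rfl))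
  have hr0 : 0 < r := by rw [hr]; positivity
  intro T hT n hn
  refine aux_cmp τ η lam s₀ i₀ k hτ hη hlam hs T M
    (fun n s => (1 - (1 - θ0) * Real.exp (-r * s)) * E n - M * Real.exp (n - L + K * s))
    (fun n s => J n (t1 + s))
    (fun n hn => by apply Continuous.continuousOn; fun_prop)
    (fun n hn => aux_shift_cont _ _ _ ht1 (hcont n hn))
    (fun n hn s hs => ?_)
    (fun n hn s hs => by linarith [hnn n hn (t1 + s) (by linarith [hs.1])])
    ?_
    (fun n hn r hr _ => ⟨_, aux_shift_deriv _ _ _ _ (hode n hn (t1 + r) (by linarith)), le_rfl⟩)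
    ?_ n hn T ⟨hT, le_rfl⟩
  · have h1 : 0 ≤ (1 - θ0) * Real.exp (-r * s) := mul_nonneg (by linarith) (Real.exp_pos _).le
    have h2 : 0 ≤ M * Real.exp (n - L + K * s) := by positivity
    have h3 := hδE n hn
    have h4 := hEM n hn
    nlinarith
  · intro n hn
    have h3 := hδE n hn
    have h4 := hEM n hn
    simp only [mul_zero, Real.exp_zero, add_zero, mul_one, sub_sub_cancel]
    by_cases hnL : (n : ℝ) ≤ L
    · have := hJ n hn hnL
      have h2 : 0 ≤ M * Real.exp (n - L) := by positivity
      have h5 : θ0 * E n ≤ θ0 * M := by gcongr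
      linarith
    · push Not at hnL
      have h5 : 1 ≤ Real.exp (n - L) := Real.one_le_exp (by linarith)
      have := hnn n hn t1 ht1
      nlinarith
  · intro n hn s hs0 hsT hlt
    have hJn := hnn n hn (t1 + s) (by linarith)
    set θ := 1 - (1 - θ0) * Real.exp (-r * s) with hθ
    set v := M * Real.exp (n - L + K * s) with hv
    have hv0 : 0 < v := by positivity
    have hexp1 : Real.exp (-r * s) ≤ 1 := Real.exp_le_one_iff.2 (by nlinarith)
    have hθa : θ0 ≤ θ := by rw [hθ]; nlinarith
    have hθb : θ ≤ 1 := by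
      rw [hθ]
      have : 0 ≤ (1 - θ0) * Real.exp (-r * s) := mul_nonneg (by linarith) (Real.exp_pos _).le
      linarith
    have hd : HasDerivAt (fun s : ℝ => (1 - (1 - θ0) * Real.exp (-r * s)) * E n - M * Real.exp (n - L + K * s))
        (r * (1 - θ) * E n - K * v) s := by
      have h1 : HasDerivAt (fun s : ℝ => Real.exp (-r * s)) (Real.exp (-r * s) * (-r * 1)) s :=
        ((hasDerivAt_id s).const_mul (-r)).exp
      have h2 : HasDerivAt (fun s : ℝ => Real.exp (n - L + K * s)) (Real.exp (n - L + K * s) * (K * 1)) s :=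
        (((hasDerivAt_id s).const_mul K).const_add ((n : ℝ) - L)).exp
      have h3 := (((h1.const_mul (1 - θ0)).const_sub 1).mul_const (E n)).sub (h2.const_mul M)
      refine HasDerivAt.congr_deriv h3 ?_
      rw [hθ, hv]; ring
    refine ⟨_, hd, ?_⟩
    have hc1 := aux_f_conc τ η s₀ θ0 θ δ M (E n) hτ hs hθ0 hθa hθb hδ (hδE n hn) (hEM n hn)
    rw [← hr] at hc1
    have hc2 := aux_lip τ η s₀ 0 (θ * E n) (θ * E n - v) hτ hη hs (by linarith) (by linarith)
    simp only [mul_zero, Real.exp_zero, mul_one] at hc2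
    have hE0 := hEr n hn
    have hk0 : (0 : ℝ) ≤ k := Nat.cast_nonneg k
    have hnext : M * Real.exp (((n + 1 : ℕ) : ℝ) - L + K * s) = v * Real.exp 1 := by
      rw [hv, mul_assoc, ← Real.exp_add]; push_cast; ring_nf
    have he1 : 1 ≤ Real.exp 1 := Real.one_le_exp (by norm_num)
    unfold aux_rhs at hE0 ⊢
    by_cases h1 : n = 1
    · subst h1
      simp only [if_true] at hE0 ⊢
      rw [← hv]
      norm_num at hnext
      push_cast
      rw [hnext]
      have g : i₀ * θ ≤ i₀ := by nlinarith
      have g2 : θ * (fSIR τ η s₀ (E 1) + i₀ + lam * (k + 1) * (-E 1 + E 2)) = 0 := by rw [hE0, mul_zero]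
      have g3 : 0 ≤ lam * (k + 1) * v := by positivity
      rw [hK]
      have g4 : fSIR τ η s₀ (θ * E 1 - v) ≥ θ * fSIR τ η s₀ (E 1) + r * (1 - θ) * E 1 - s₀ * τ * v := by
        linarith
      nlinarith only [g, g2, g3, g4]
    · simp only [h1, if_false] at hE0 ⊢
      have hprev : M * Real.exp (((n - 1 : ℕ) : ℝ) - L + K * s) = v * Real.exp (-1) := by
        rw [hv, mul_assoc, ← Real.exp_add, Nat.cast_sub hn]; push_cast; ring_nf
      rw [← hv, hnext, hprev]
      have g2 : θ * (fSIR τ η s₀ (E n) + lam * (E (n - 1) - (k + 1) * E n + k * E (n + 1))) = 0 := by rw [hE0, mul_zero]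
      have g3 : 0 ≤ lam * (k + 1) * v := by positivity
      have g5 : lam * v * Real.exp (-1) ≤ lam * v * Real.exp 1 := by gcongr; norm_num
      rw [hK]
      have g4 : fSIR τ η s₀ (θ * E n - v) ≥ θ * fSIR τ η s₀ (E n) + r * (1 - θ) * E n - s₀ * τ * v := by
        linarith
      nlinarith only [g2, g3, g4, g5]

/-- Inner spreading on the tree: assume `𝓡₀ = s₀τ/η > 1` and `0 < λ < λ_c`, and let
`c_*^k = min_{γ>0} [η(𝓡₀-1) + λ(e^γ - (k+1) + k e^{-γ})]/γ`. Then for every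
`c ∈ (0, c_*^k)`, `sup_{1 ≤ n ≤ ct} |𝓘_n(t) - I_n^∞| → 0` as `t → +∞`. -/
theorem stmt_13 (τ η lam s₀ i₀ : ℝ) (hτ : 0 < τ) (hη : 0 < η) (hlam : 0 < lam)
    (hs₀ : s₀ ∈ Set.Ioo (0 : ℝ) 1) (hi₀ : i₀ ∈ Set.Ioo (0 : ℝ) 1)
    (k : ℕ) (hk : 2 ≤ k) (hR0 : 1 < s₀ * τ / η)
    (hlamc : lam < η * (s₀ * τ / η - 1) / ((k : ℝ) + 1 - 2 * Real.sqrt k))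
    (cstark : ℝ)
    (hcstark : IsLeast {v : ℝ | ∃ γ : ℝ, 0 < γ ∧
        v = (η * (s₀ * τ / η - 1)
          + lam * (Real.exp γ - ((k : ℝ) + 1) + (k : ℝ) * Real.exp (-γ))) / γ} cstark)
    (𝓘 : ℕ → ℝ → ℝ)
    (hcont : ∀ n : ℕ, 1 ≤ n → ContinuousOn (𝓘 n) (Set.Ici (0 : ℝ)))
    (hode : ∀ n : ℕ, 2 ≤ n → ∀ t : ℝ, 0 < t → HasDerivAt (𝓘 n)
        (fSIR τ η s₀ (𝓘 n t)
          + lam * (𝓘 (n - 1) t - ((k : ℝ) + 1) * 𝓘 n t + (k : ℝ) * 𝓘 (n + 1) t)) t)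
    (hode1 : ∀ t : ℝ, 0 < t → HasDerivAt (𝓘 1)
        (fSIR τ η s₀ (𝓘 1 t) + i₀ + lam * ((k : ℝ) + 1) * (-𝓘 1 t + 𝓘 2 t)) t)
    (hbdd : ∀ T : ℝ, 0 < T → ∃ M : ℝ, ∀ n : ℕ, 1 ≤ n →
        ∀ t ∈ Set.Icc (0 : ℝ) T, |𝓘 n t| ≤ M)
    (hinit : ∀ n : ℕ, 1 ≤ n → 𝓘 n 0 = 0)
    (Iinf : ℕ → ℝ) (hIinf : TreeStationary τ η lam s₀ i₀ k Iinf) :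
    ∀ c : ℝ, 0 < c → c < cstark → ∀ ε : ℝ, 0 < ε →
      ∀ᶠ t : ℝ in Filter.atTop,
        ∀ n : ℕ, 1 ≤ n → (n : ℝ) ≤ c * t → |𝓘 n t - Iinf n| ≤ ε := by
  intro c hc hcs ε hε
  have hs := hs₀.1
  have hi := hi₀.1
  obtain ⟨hEpos, ⟨M, hEM⟩, hE2, hE1⟩ := hIinf
  have hode' : ∀ n : ℕ, 1 ≤ n → ∀ t : ℝ, 0 < t →
      HasDerivAt (𝓘 n) (aux_rhs τ η lam s₀ i₀ k (fun m => 𝓘 m t) n) t := by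
    intro n hn t ht
    unfold aux_rhs
    by_cases h1 : n = 1
    · subst h1; simpa using hode1 t ht
    · simp only [h1, if_false]; exact hode n (by omega) t ht
  have hEr : ∀ n, 1 ≤ n → aux_rhs τ η lam s₀ i₀ k Iinf n = 0 := by
    intro n hn
    unfold aux_rhs
    by_cases h1 : n = 1
    · subst h1; simpa using hE1.symm
    · simp only [h1, if_false]; exact (hE2 n (by omega)).symm
  have hnn := aux_nonneg τ η lam s₀ i₀ k hτ hη hlam hs hi 𝓘 hcont hode' hbdd hinit
  have hle := aux_le τ η lam s₀ i₀ k hτ hη hlam hs 𝓘 hcont hode' hbdd hinit Iinf hEpos hEr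
  have hmono := aux_mono τ η lam s₀ i₀ k hτ hη hlam hs hi 𝓘 hcont hode' hbdd hinit
  have hpos := aux_pos τ η lam s₀ i₀ k hlam hi 𝓘 hode' hnn 1 one_pos
  have hf0 : η * (s₀ * τ / η - 1) = s₀ * τ - η := by field_simp
  obtain ⟨α, ω, c2, e, hα, hω, hω1, hcc2, he, hsin, hD⟩ :=
    aux_speed τ η lam s₀ hlam k hk cstark c hc hcs (fun γ hγ => by
      have := hcstark.2 ⟨γ, hγ, rfl⟩
      rwa [hf0] at this)
  have hc2 : 0 < c2 := hc.trans hcc2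
  obtain ⟨δ, hδ, hsp⟩ := aux_spread τ η lam s₀ i₀ k hτ hη hlam hs 𝓘 hcont hode' hnn hmono hpos
    α ω c2 e hα hω hω1 hc2 he hsin hD
  have hδE : ∀ n, 1 ≤ n → δ ≤ Iinf n := by
    intro n hn
    have h0 : 0 ≤ (n : ℝ) / c2 := by positivity
    refine (hsp n hn (1 + n / c2) (by linarith) ?_).trans (hle n hn _ (by linarith))
    apply le_of_eq; field_simp; ring
  have hδM : δ ≤ M := (hδE 1 le_rfl).trans (hEM 1 le_rfl)
  have hM0 : 0 < M := hδ.trans_le hδM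
  set θ0 := δ / M with hθ0d
  have hθ0 : 0 < θ0 := by positivity
  have hθ1 : θ0 ≤ 1 := (div_le_one hM0).2 hδM
  have hθM : θ0 * M ≤ δ := by rw [hθ0d, div_mul_cancel₀ _ hM0.ne']
  obtain ⟨r, hr⟩ : ∃ r, r = s₀ * Real.exp (-τ * M) * θ0 ^ 2 * τ ^ 2 * δ / 2 := ⟨_, rfl⟩
  obtain ⟨K, hK⟩ : ∃ K, K = s₀ * τ + lam * (k + 1) * Real.exp 1 := ⟨_, rfl⟩
  have hr0 : 0 < r := by rw [hr]; positivity
  have tT : Tendsto (fun T : ℝ => M * Real.exp (-(r * T))) atTop (𝓝 (M * 0)) := by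
    apply Tendsto.const_mul
    exact Real.tendsto_exp_neg_atTop_nhds_zero.comp (tendsto_id.const_mul_atTop hr0)
  obtain ⟨T, hT1, hT0⟩ := ((tT.eventually_lt_const (show M * 0 < ε / 2 by linarith)).and
    (eventually_ge_atTop (0 : ℝ))).exists
  have tt : Tendsto (fun t : ℝ => M * Real.exp (-((c2 - c) * t + (-(c2 * (T + 1)) - K * T)))) atTop (𝓝 (M * 0)) := by
    apply Tendsto.const_mul
    apply Real.tendsto_exp_neg_atTop_nhds_zero.comp
    apply tendsto_atTop_add_const_right
    exact tendsto_id.const_mul_atTop (by linarith)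
  filter_upwards [tt.eventually_lt_const (show M * 0 < ε / 2 by linarith),
    eventually_ge_atTop (T + 1)] with t ht1 ht2 n hn hnt
  have hup := hle n hn t (by linarith)
  have hlow := aux_final τ η lam s₀ i₀ k hτ hη hlam hs hi 𝓘 hcont hode' hnn Iinf hEr δ M θ0 r K
    hδ hδE hEM hθ0 hθ1 hθM hr hK (t - T) (c2 * (t - T - 1)) (by linarith)
    (fun m hm hml => hsp m hm (t - T) (by linarith) hml) T hT0 n hn
  rw [sub_add_cancel] at hlow
  have h1 : M * Real.exp (n - c2 * (t - T - 1) + K * T) ≤ ε / 2 := by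
    refine le_trans ?_ ht1.le
    gcongr
    nlinarith
  have h2 : (1 - θ0) * Real.exp (-r * T) * Iinf n ≤ ε / 2 := by
    refine le_trans ?_ hT1.le
    have a1 := hEM n hn
    have a2 := hEpos n hn
    have a3 : -r * T = -(r * T) := by ring
    rw [a3]
    have a4 := Real.exp_pos (-(r * T))
    calc (1 - θ0) * Real.exp (-(r * T)) * Iinf n ≤ 1 * Real.exp (-(r * T)) * M := by
          gcongr; linarith
      _ = _ := by ring
  rw [abs_le]
  constructor <;> linarith
end

section
/- Let k ≥ 2 be an integer, assume 𝓡₀ > 1 and 0 < λ < λ_c := η(𝓡₀ - 1)/(k + 1 - 2√k). Define c_*^k := min_{γ>0} [η(𝓡₀ - 1) + λ(e^{γ} - (k+1) + k e^{-γ})]/γ. Let (𝓘_n(t))_{n≥1} be the solution of the tree equation 𝓘_n'(t) = f(𝓘_n(t)) + λ(𝓘_{n-1}(t) - (k+1)𝓘_n(t) + k𝓘_{n+1}(t)) for n ≥ 2, 𝓘_1'(t) = f(𝓘_1(t)) + i₀ + λ(k+1)(-𝓘_1(t) + 𝓘_2(t)), with 𝓘_n(0) = 0 for all n ≥ 1.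 Then for every c > c_*^k, lim_{t→+∞} sup_{n ≥ ct} |𝓘_n(t)| = 0. -/
theorem comp_aux (w w' : ℕ → ℝ → ℝ) (T B C M : ℝ) (hB : 0 ≤ B) (hC : 0 ≤ C) (hM : 0 ≤ M)
    (hc : ∀ n, 1 ≤ n → ContinuousOn (w n) (Set.Icc 0 T))
    (hd : ∀ n, 1 ≤ n → ∀ t ∈ Set.Ioo 0 T, HasDerivAt (w n) (w' n t) t)
    (hlow : ∀ n, 1 ≤ n → ∀ t ∈ Set.Icc 0 T, -M ≤ w n t)
    (h0 : ∀ n, 1 ≤ n → 0 ≤ w n 0)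
    (hq : ∀ n, 1 ≤ n → ∀ t ∈ Set.Ioo 0 T, ∀ m : ℝ, 0 ≤ m → (∀ l, 1 ≤ l → -m ≤ w l t) →
      -(C * m) ≤ w' n t + B * w n t) :
    ∀ n, 1 ≤ n → ∀ t ∈ Set.Icc 0 T, 0 ≤ w n t := by
  have key : ∀ j : ℕ, ∀ n, 1 ≤ n → ∀ t ∈ Set.Icc 0 T,
      -(M * Real.exp (B * T) * ((C * t) ^ j / (j.factorial : ℝ))) ≤ Real.exp (B * t) * w n t := by
    intro j
    induction j with
    | zero =>
      intro n hn t ht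
      have h1 := hlow n hn t ht
      have h2 : Real.exp (B * t) ≤ Real.exp (B * T) :=
        Real.exp_le_exp.mpr (mul_le_mul_of_nonneg_left ht.2 hB)
      have h3 := Real.exp_pos (B * t)
      simp only [pow_zero, Nat.factorial_zero, Nat.cast_one, div_one, mul_one]
      nlinarith
    | succ j ih =>
      intro n hn t ht
      set K := M * Real.exp (B * T) with hK
      have hK0 : 0 ≤ K := by positivity
      let g : ℝ → ℝ := fun s => Real.exp (B * s) * w n s +
        K * ((C * s) ^ (j+1) / ((j+1).factorial : ℝ))
      have hder : ∀ s ∈ Set.Ioo 0 T, HasDerivAt g (Real.exp (B * s) * (w' n s + B * w n s)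
          + K * (C * ((C * s) ^ j / (j.factorial : ℝ)))) s := by
        intro s hs
        have e1 : HasDerivAt (fun s => Real.exp (B * s)) (Real.exp (B * s) * B) s := by
          simpa using ((hasDerivAt_id s).const_mul B).exp
        have e2 : HasDerivAt (fun s => (C * s) ^ (j+1)) (((j + 1 : ℕ) : ℝ) * (C * s) ^ j * C) s := by
          simpa using ((hasDerivAt_id s).const_mul C).fun_pow (j+1)
        have e3 := (e1.mul (hd n hn s hs)).add ((e2.div_const ((j+1).factorial : ℝ)).const_mul K)
        refine e3.congr_deriv ?_
        have hj : (j.factorial : ℝ) ≠ 0 := by positivity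
        have hj1 : ((j : ℝ) + 1) ≠ 0 := by positivity
        rw [Nat.factorial_succ]
        push_cast
        field_simp
        ring
      have hmono : MonotoneOn g (Set.Icc 0 T) := by
        apply monotoneOn_of_deriv_nonneg (convex_Icc 0 T)
        · apply ContinuousOn.add
          · exact (by fun_prop : ContinuousOn (fun s => Real.exp (B * s)) _).mul (hc n hn)
          · fun_prop
        · rw [interior_Icc]
          intro s hs
          exact (hder s hs).differentiableAt.differentiableWithinAt
        · rw [interior_Icc]
          intro s hs
          rw [(hder s hs).deriv]
          have hE := Real.exp_pos (B * s)
          set a := (C * s) ^ j / (j.factorial : ℝ) with ha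
          have ha0 : 0 ≤ a := by
            have := hs.1.le
            positivity
          have := hq n hn s hs (K * a / Real.exp (B * s)) (by positivity) (by
            intro l hl
            have := ih l hl s (Set.Ioo_subset_Icc_self hs)
            rw [neg_le, ← sub_nonneg]
            have h3 : K * a / Real.exp (B * s) - -w l s =
              (K * a + Real.exp (B * s) * w l s) / Real.exp (B * s) := by
              field_simp
              ring
            rw [h3]
            apply div_nonneg _ hE.le
            linarith)
          have h4 := mul_le_mul_of_nonneg_left this hE.le
          have h5 : Real.exp (B * s) * -(C * (K * a / Real.exp (B * s))) = -(K * (C * a)) := by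
            field_simp
          linarith
      have := hmono (Set.left_mem_Icc.mpr (ht.1.trans ht.2)) ht ht.1
      have h6 := h0 n hn
      simp only [g] at this
      simp at this
      linarith
  intro n hn t ht
  have hlim := (FloorSemiring.tendsto_pow_div_factorial_atTop (C * t)).const_mul
    (M * Real.exp (B * T)) |>.neg
  have h := le_of_tendsto' hlim (fun j => key j n hn t ht)
  simp only [mul_zero, neg_zero] at h
  exact (mul_nonneg_iff_of_pos_left (Real.exp_pos _)).mp h

/-- Outer spreading on the tree: assume `𝓡₀ = s₀τ/η > 1` and `0 < λ < λ_c`, and let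
`c_*^k = min_{γ>0} [η(𝓡₀-1) + λ(e^γ - (k+1) + k e^{-γ})]/γ`. Then for every
`c > c_*^k`, `sup_{n ≥ ct} |𝓘_n(t)| → 0` as `t → +∞`. -/
theorem stmt_14 (τ η lam s₀ i₀ : ℝ) (hτ : 0 < τ) (hη : 0 < η) (hlam : 0 < lam)
    (hs₀ : s₀ ∈ Set.Ioo (0 : ℝ) 1) (hi₀ : i₀ ∈ Set.Ioo (0 : ℝ) 1)
    (k : ℕ) (hk : 2 ≤ k) (hR0 : 1 < s₀ * τ / η)
    (hlamc : lam < η * (s₀ * τ / η - 1) / ((k : ℝ) + 1 - 2 * Real.sqrt k))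
    (cstark : ℝ)
    (hcstark : IsLeast {v : ℝ | ∃ γ : ℝ, 0 < γ ∧
        v = (η * (s₀ * τ / η - 1)
          + lam * (Real.exp γ - ((k : ℝ) + 1) + (k : ℝ) * Real.exp (-γ))) / γ} cstark)
    (𝓘 : ℕ → ℝ → ℝ)
    (hcont : ∀ n : ℕ, 1 ≤ n → ContinuousOn (𝓘 n) (Set.Ici (0 : ℝ)))
    (hode : ∀ n : ℕ, 2 ≤ n → ∀ t : ℝ, 0 < t → HasDerivAt (𝓘 n)
        (fSIR τ η s₀ (𝓘 n t)
          + lam * (𝓘 (n - 1) t - ((k : ℝ) + 1) * 𝓘 n t + (k : ℝ) * 𝓘 (n + 1) t)) t)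
    (hode1 : ∀ t : ℝ, 0 < t → HasDerivAt (𝓘 1)
        (fSIR τ η s₀ (𝓘 1 t) + i₀ + lam * ((k : ℝ) + 1) * (-𝓘 1 t + 𝓘 2 t)) t)
    (hbdd : ∀ T : ℝ, 0 < T → ∃ M : ℝ, ∀ n : ℕ, 1 ≤ n →
        ∀ t ∈ Set.Icc (0 : ℝ) T, |𝓘 n t| ≤ M)
    (hinit : ∀ n : ℕ, 1 ≤ n → 𝓘 n 0 = 0) :
    ∀ c : ℝ, cstark < c → ∀ ε : ℝ, 0 < ε →
      ∀ᶠ t : ℝ in Filter.atTop,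
        ∀ n : ℕ, 1 ≤ n → c * t ≤ (n : ℝ) → |𝓘 n t| ≤ ε := by
  obtain ⟨⟨γ, hγ, hcγ⟩, -⟩ := hcstark
  obtain ⟨hs0, -⟩ := hs₀
  obtain ⟨hi0, -⟩ := hi₀
  have hk2 : (2 : ℝ) ≤ k := by exact_mod_cast hk
  have hηR : η * (s₀ * τ / η - 1) = s₀ * τ - η := by field_simp
  rw [hηR] at hcγ hlamc
  set P := s₀ * τ - η + lam * (Real.exp γ - ((k : ℝ) + 1) + (k : ℝ) * Real.exp (-γ)) with hP
  have hPc : P = cstark * γ := by rw [hcγ]; field_simp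
  have hee : Real.exp γ * Real.exp (-γ) = 1 := by rw [← Real.exp_add]; simp
  have hP0 : 0 ≤ P := by
    have hsq : Real.sqrt k * Real.sqrt k = k := Real.mul_self_sqrt (by positivity)
    have hs1 : 1 < Real.sqrt k := by
      rw [Real.lt_sqrt (by norm_num)]; linarith
    have hden : 0 < (k : ℝ) + 1 - 2 * Real.sqrt k := by nlinarith
    rw [lt_div_iff₀ hden] at hlamc
    have ham : 2 * Real.sqrt k ≤ Real.exp γ + k * Real.exp (-γ) := by
      have h1 : 0 ≤ Real.exp (-γ) * (Real.exp γ - Real.sqrt k) ^ 2 := by positivity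
      have h2 : Real.exp (-γ) * (Real.exp γ - Real.sqrt k) ^ 2
        = Real.exp γ * (Real.exp γ * Real.exp (-γ)) - 2 * Real.sqrt k * (Real.exp γ * Real.exp (-γ))
          + (Real.sqrt k * Real.sqrt k) * Real.exp (-γ) := by ring
      rw [h2, hee, hsq] at h1
      linarith
    have := mul_le_mul_of_nonneg_left ham hlam.le
    rw [hP]
    nlinarith
  have hB : 0 ≤ η + lam * ((k : ℝ) + 1) := by positivity
  have hlin : ∀ x : ℝ, 1 - Real.exp (-τ * x) ≤ τ * x := by
    intro x
    have := Real.add_one_le_exp (-τ * x)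
    linarith
  -- derivative function
  let D : ℕ → ℝ → ℝ := fun n t => if n = 1 then
      fSIR τ η s₀ (𝓘 1 t) + i₀ + lam * ((k : ℝ) + 1) * (-𝓘 1 t + 𝓘 2 t) else
      fSIR τ η s₀ (𝓘 n t)
          + lam * (𝓘 (n - 1) t - ((k : ℝ) + 1) * 𝓘 n t + (k : ℝ) * 𝓘 (n + 1) t)
  have hD : ∀ n, 1 ≤ n → ∀ t, 0 < t → HasDerivAt (𝓘 n) (D n t) t := by
    intro n hn t ht
    by_cases h1 : n = 1
    · subst h1
      simpa [D] using hode1 t ht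
    · simp only [D, if_neg h1]
      exact hode n (by omega) t ht
  have hnn : ∀ T : ℝ, 0 < T → ∀ n, 1 ≤ n → ∀ t ∈ Set.Icc 0 T, 0 ≤ 𝓘 n t := by
    intro T hT
    obtain ⟨M, hM⟩ := hbdd T hT
    have hM0 : 0 ≤ M := (abs_nonneg _).trans (hM 1 le_rfl 0 ⟨le_rfl, hT.le⟩)
    refine comp_aux 𝓘 D T (η + lam * (k + 1)) (s₀ * (Real.exp (τ * M) * τ) + lam * (k + 1)) M
      hB (by positivity) hM0
      (fun n hn => (hcont n hn).mono Set.Icc_subset_Ici_self)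
      (fun n hn t ht => hD n hn t ht.1)
      (fun n hn t ht => (abs_le.mp (hM n hn t ht)).1)
      (fun n hn => (hinit n hn).ge) ?_
    intro n hn t ht m hm hl
    have hf : -(Real.exp (τ * M) * τ * m) ≤ 1 - Real.exp (-τ * 𝓘 n t) := by
      have h1 := hl n hn
      have h2 := (abs_le.mp (hM n hn t (Set.Ioo_subset_Icc_self ht))).1
      have hpos : 0 ≤ Real.exp (τ * M) * τ * m := by positivity
      rcases le_or_gt 0 (𝓘 n t) with h | h
      · have : Real.exp (-τ * 𝓘 n t) ≤ 1 := by
          rw [Real.exp_le_one_iff]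
          nlinarith
        linarith
      · have h3 := Real.add_one_le_exp (τ * 𝓘 n t)
        have h4 : Real.exp (-τ * 𝓘 n t) * Real.exp (τ * 𝓘 n t) = 1 := by
          rw [← Real.exp_add]; simp
        have h5 : Real.exp (-τ * 𝓘 n t) ≤ Real.exp (τ * M) := by
          rw [Real.exp_le_exp]; nlinarith
        have h6 := Real.exp_pos (-τ * 𝓘 n t)
        have h7 := mul_le_mul_of_nonneg_left h3 h6.le
        rw [h4] at h7
        have h8 : Real.exp (-τ * 𝓘 n t) * (τ * (-𝓘 n t)) ≤ Real.exp (τ * M) * (τ * m) := by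
          apply mul_le_mul h5 _ _ (Real.exp_pos _).le
          · apply mul_le_mul_of_nonneg_left _ hτ.le
            linarith
          · apply mul_nonneg hτ.le; linarith
        linarith
    have hf' := mul_le_mul_of_nonneg_left hf hs0.le
    by_cases h1 : n = 1
    · subst h1
      have h2 := mul_le_mul_of_nonneg_left (hl 2 (by norm_num))
        (by positivity : 0 ≤ lam * ((k : ℝ) + 1))
      simp only [D, if_true, fSIR]
      linarith
    · have h2 := mul_le_mul_of_nonneg_left (hl (n - 1) (by omega)) hlam.le
      have h3 := mul_le_mul_of_nonneg_left (hl (n + 1) (by omega))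
        (by positivity : 0 ≤ lam * (k : ℝ))
      simp only [D, if_neg h1, fSIR]
      linarith
  have hgap : 0 < lam * (Real.exp γ - Real.exp (-γ)) * Real.exp (-γ) := by
    have : Real.exp (-γ) < Real.exp γ := Real.exp_lt_exp.mpr (by linarith)
    have h2 : 0 < Real.exp γ - Real.exp (-γ) := by linarith
    positivity
  obtain ⟨A, hA0, hA⟩ : ∃ A : ℝ, 0 < A ∧
      A * (lam * (Real.exp γ - Real.exp (-γ)) * Real.exp (-γ)) = i₀ :=
    ⟨i₀ / (lam * (Real.exp γ - Real.exp (-γ)) * Real.exp (-γ)), by positivity, by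
      rw [div_mul_cancel₀ _ hgap.ne']⟩
  let u : ℕ → ℝ → ℝ := fun n t => A * Real.exp (P * t - γ * n)
  have hu0 : ∀ n t, 0 < u n t := fun n t => mul_pos hA0 (Real.exp_pos _)
  have hus : ∀ n t, u (n + 1) t = u n t * Real.exp (-γ) := by
    intro n t
    simp only [u]
    rw [mul_assoc, ← Real.exp_add]
    push_cast
    ring_nf
  have hud : ∀ n t, HasDerivAt (u n) (P * u n t) t := by
    intro n t
    have := ((((hasDerivAt_id t).const_mul P).sub_const (γ * n)).exp).const_mul A
    refine this.congr_deriv ?_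
    simp only [u, id]
    ring
  have hup : ∀ T : ℝ, 0 < T → ∀ n, 1 ≤ n → ∀ t ∈ Set.Icc 0 T, 0 ≤ u n t - 𝓘 n t := by
    intro T hT
    obtain ⟨M, hM⟩ := hbdd T hT
    have hM0 : 0 ≤ M := (abs_nonneg _).trans (hM 1 le_rfl 0 ⟨le_rfl, hT.le⟩)
    refine comp_aux (fun n t => u n t - 𝓘 n t) (fun n t => P * u n t - D n t) T
      (η + lam * (k + 1)) (s₀ * τ + lam * (k + 1)) M
      hB (by positivity) hM0
      (fun n hn => ContinuousOn.sub (fun t _ => (hud n t).continuousAt.continuousWithinAt)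
        ((hcont n hn).mono Set.Icc_subset_Ici_self))
      (fun n hn t ht => (hud n t).sub (hD n hn t ht.1))
      ?_ ?_ ?_
    · intro n hn t ht
      have h1 := (abs_le.mp (hM n hn t ht)).2
      have h2 := hu0 n t
      linarith
    · intro n hn
      have h2 := hu0 n 0
      simp only [hinit n hn]
      linarith
    intro n hn t ht m hm hl
    have hf := mul_le_mul_of_nonneg_left (hlin (𝓘 n t)) hs0.le
    have hn0 := mul_le_mul_of_nonneg_left (hl n hn) (by positivity : 0 ≤ s₀ * τ)
    by_cases h1 : n = 1
    · subst h1
      have h2 := mul_le_mul_of_nonneg_left (hl 2 (by norm_num))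
        (by positivity : 0 ≤ lam * ((k : ℝ) + 1))
      have h3 : u 2 t = u 1 t * Real.exp (-γ) := hus 1 t
      have h4 : i₀ ≤ lam * (Real.exp γ - Real.exp (-γ)) * u 1 t := by
        have h5 : A * Real.exp (-γ) ≤ u 1 t := by
          apply mul_le_mul_of_nonneg_left _ hA0.le
          rw [Real.exp_le_exp]
          have := mul_nonneg hP0 ht.1.le
          push_cast
          linarith
        have h6 : 0 ≤ lam * (Real.exp γ - Real.exp (-γ)) :=
          (pos_of_mul_pos_left hgap (Real.exp_pos _).le).le
        have := mul_le_mul_of_nonneg_left h5 h6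
        linarith
      rw [h3] at h2
      simp only [D, if_true, fSIR, hP]
      linarith
    · obtain ⟨j, rfl⟩ : ∃ j, n = j + 1 := ⟨n - 1, by omega⟩
      have h2 := mul_le_mul_of_nonneg_left (hl j (by omega)) hlam.le
      have h3 := mul_le_mul_of_nonneg_left (hl (j + 1 + 1) (by omega))
        (by positivity : 0 ≤ lam * (k : ℝ))
      have h4 : u j t = u (j + 1) t * Real.exp γ := by
        rw [hus j t, mul_assoc, mul_comm (Real.exp (-γ)), hee, mul_one]
      rw [h4] at h2
      rw [hus (j + 1) t] at h3
      simp only [D, if_neg h1, fSIR, hP, Nat.add_sub_cancel]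
      linarith
  intro c hc ε hε
  have hlim : Filter.Tendsto (fun t : ℝ => A * Real.exp (-(γ * (c - cstark) * t)))
      Filter.atTop (nhds 0) := by
    have h1 : 0 < γ * (c - cstark) := mul_pos hγ (by linarith)
    have := (Real.tendsto_exp_neg_atTop_nhds_zero.comp
      (Filter.tendsto_id.const_mul_atTop h1)).const_mul A
    simpa using this
  filter_upwards [hlim.eventually_le_const hε, Filter.eventually_gt_atTop 0] with t ht ht0
  intro n hn hct
  have h1 := hnn t ht0 n hn t ⟨ht0.le, le_rfl⟩
  have h2 := hup t ht0 n hn t ⟨ht0.le, le_rfl⟩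
  rw [abs_of_nonneg h1]
  have h3 : u n t ≤ A * Real.exp (-(γ * (c - cstark) * t)) := by
    apply mul_le_mul_of_nonneg_left _ hA0.le
    rw [Real.exp_le_exp, hPc]
    have := mul_le_mul_of_nonneg_left hct hγ.le
    linarith
  linarith
end

section
/- Let k ≥ 2 be an integer and assume 𝓡₀ > 1. Regard c_*^k(λ) := min_{γ>0} [η(𝓡₀ - 1) + λ(e^{γ} - (k+1) + k e^{-γ})]/γ as a function of λ > 0, and set λ_c := η(𝓡₀ - 1)/(k + 1 - 2√k). Then c_*^k(λ) > 0 for all λ ∈ (0, λ_c), and c_*^k(λ_c) = 0. -/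
/-- Assume `𝓡₀ = s₀τ/η > 1` and let, for `λ > 0`,
`c_*^k(λ) = min_{γ>0} [η(𝓡₀-1) + λ(e^γ - (k+1) + k e^{-γ})]/γ` and
`λ_c = η(𝓡₀-1)/(k+1-2√k)`. Then `c_*^k(λ) > 0` for every `λ ∈ (0, λ_c)`, and
`c_*^k(λ_c) = 0`. -/
theorem stmt_15 (τ η s₀ : ℝ) (hτ : 0 < τ) (hη : 0 < η)
    (hs₀ : s₀ ∈ Set.Ioo (0 : ℝ) 1) (hR0 : 1 < s₀ * τ / η)
    (k : ℕ) (hk : 2 ≤ k)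
    (lamc : ℝ)
    (hlamc : lamc = η * (s₀ * τ / η - 1) / ((k : ℝ) + 1 - 2 * Real.sqrt k))
    (cstark : ℝ → ℝ)
    (hcstark : ∀ μ : ℝ, 0 < μ → μ ≤ lamc →
      IsLeast {v : ℝ | ∃ γ : ℝ, 0 < γ ∧
        v = (η * (s₀ * τ / η - 1)
          + μ * (Real.exp γ - ((k : ℝ) + 1) + (k : ℝ) * Real.exp (-γ))) / γ}
        (cstark μ)) :
    (∀ μ : ℝ, μ ∈ Set.Ioo 0 lamc → 0 < cstark μ) ∧ cstark lamc = 0 := by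
  have hA : 0 < η * (s₀ * τ / η - 1) := mul_pos hη (by linarith)
  generalize η * (s₀ * τ / η - 1) = A at *
  have hk' : (2 : ℝ) ≤ k := by exact_mod_cast hk
  have hr2 : Real.sqrt k ^ 2 = k := Real.sq_sqrt (by linarith)
  have hr0 : 0 ≤ Real.sqrt k := Real.sqrt_nonneg _
  generalize Real.sqrt k = r at *
  generalize (k : ℝ) = K at *
  subst hr2
  have hr : 1 < r := by nlinarith
  have hD : 0 < r ^ 2 + 1 - 2 * r := by nlinarith [mul_pos (sub_pos.2 hr) (sub_pos.2 hr)]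
  have hl0 : 0 < lamc := by rw [hlamc]; positivity
  have hlD : lamc * (r ^ 2 + 1 - 2 * r) = A := by rw [hlamc]; exact div_mul_cancel₀ A hD.ne'
  have key : ∀ γ : ℝ, -(r ^ 2 + 1 - 2 * r) ≤
      Real.exp γ - (r ^ 2 + 1) + r ^ 2 * Real.exp (-γ) := by
    intro γ
    have hE := Real.exp_pos γ
    have h : Real.exp γ - (r ^ 2 + 1) + r ^ 2 * Real.exp (-γ) + (r ^ 2 + 1 - 2 * r)
        = (Real.exp γ - r) ^ 2 / Real.exp γ := by
      rw [Real.exp_neg]; field_simp; ring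
    have : 0 ≤ (Real.exp γ - r) ^ 2 / Real.exp γ := by positivity
    linarith
  constructor
  · rintro μ ⟨h0, h1⟩
    obtain ⟨γ, hγ, hv⟩ := (hcstark μ h0 h1.le).1
    rw [hv]
    apply div_pos _ hγ
    have := mul_le_mul_of_nonneg_left (key γ) h0.le
    have := mul_lt_mul_of_pos_right h1 hD
    linarith
  · have hL := hcstark lamc hl0 le_rfl
    apply le_antisymm
    · apply hL.2
      refine ⟨Real.log r, Real.log_pos hr, ?_⟩
      have hrp : 0 < r := by linarith
      rw [Real.exp_neg, Real.exp_log hrp]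
      have : A + lamc * (r - (r ^ 2 + 1) + r ^ 2 * r⁻¹) = 0 := by
        rw [← hlD]; field_simp; ring
      rw [this, zero_div]
    · obtain ⟨γ, hγ, hv⟩ := hL.1
      rw [hv]
      apply div_nonneg _ hγ.le
      have := mul_le_mul_of_nonneg_left (key γ) hl0.le
      linarith
end

section
/- Let k ≥ 2 be an integer and assume 𝓡₀ > 1. Regard c_*^k(λ) := min_{γ>0} [η(𝓡₀ - 1) + λ(e^{γ} - (k+1) + k e^{-γ})]/γ as a function of λ, and set λ₀ := η(𝓡₀ - 1)/((k-1) ln k) and λ_c := η(𝓡₀ - 1)/(k + 1 - 2√k). Then λ₀ < λ_c, the map λ ↦ c_*^k(λ) is monotone increasing on (0, λ₀) and monotone decreasing on (λ₀, λ_c). -/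
/-- Assume `𝓡₀ = s₀τ/η > 1` and let, for `λ > 0`,
`c_*^k(λ) = min_{γ>0} [η(𝓡₀-1) + λ(e^γ - (k+1) + k e^{-γ})]/γ`,
`λ₀ = η(𝓡₀-1)/((k-1) ln k)` and `λ_c = η(𝓡₀-1)/(k+1-2√k)`. Then `λ₀ < λ_c`, and
`λ ↦ c_*^k(λ)` is monotone increasing on `(0, λ₀)` and monotone decreasing on
`(λ₀, λ_c)`. -/
theorem stmt_16 (τ η s₀ : ℝ) (hτ : 0 < τ) (hη : 0 < η)
    (hs₀ : s₀ ∈ Set.Ioo (0 : ℝ) 1) (hR0 : 1 < s₀ * τ / η)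
    (k : ℕ) (hk : 2 ≤ k)
    (lam₀ lamc : ℝ)
    (hlam₀ : lam₀ = η * (s₀ * τ / η - 1) / (((k : ℝ) - 1) * Real.log k))
    (hlamc : lamc = η * (s₀ * τ / η - 1) / ((k : ℝ) + 1 - 2 * Real.sqrt k))
    (cstark : ℝ → ℝ)
    (hcstark : ∀ μ : ℝ, 0 < μ →
      IsLeast {v : ℝ | ∃ γ : ℝ, 0 < γ ∧
        v = (η * (s₀ * τ / η - 1)
          + μ * (Real.exp γ - ((k : ℝ) + 1) + (k : ℝ) * Real.exp (-γ))) / γ}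
        (cstark μ)) :
    lam₀ < lamc ∧
    MonotoneOn cstark (Set.Ioo 0 lam₀) ∧
    AntitoneOn cstark (Set.Ioo lam₀ lamc) := by
  have hk2 : (2:ℝ) ≤ (k:ℝ) := by exact_mod_cast hk
  have hk0 : (0:ℝ) < (k:ℝ) := by linarith
  generalize (k:ℝ) = K at *
  have hA : 0 < η * (s₀ * τ / η - 1) := mul_pos hη (by linarith)
  generalize η * (s₀ * τ / η - 1) = A at *
  have hL : 0 < Real.log K := Real.log_pos (by linarith)
  have hK1 : 0 < K - 1 := by linarith
  have hden : 0 < (K - 1) * Real.log K := mul_pos hK1 hL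
  have hl0 : 0 < lam₀ := by rw [hlam₀]; positivity
  have hl0A : lam₀ * ((K - 1) * Real.log K) = A := by
    rw [hlam₀]; field_simp
  -- the tangent line bound
  have htan : ∀ γ : ℝ, (K - 1) * (γ - Real.log K)
      ≤ Real.exp γ - (K + 1) + K * Real.exp (-γ) := by
    intro γ
    have h1 : Real.exp γ = K * Real.exp (γ - Real.log K) := by
      rw [Real.exp_sub, Real.exp_log hk0]; field_simp
    have h2 : K * Real.exp (-γ) = Real.exp (-(γ - Real.log K)) := by
      rw [neg_sub, Real.exp_sub, Real.exp_log hk0, Real.exp_neg]; field_simp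
    have h3 := Real.add_one_le_exp (γ - Real.log K)
    have h4 := Real.add_one_le_exp (-(γ - Real.log K))
    rw [h2, h1]
    nlinarith [mul_le_mul_of_nonneg_left h3 hk0.le]
  have hlow : ∀ γ : ℝ, 0 < γ → A / Real.log K ≤
      (A + lam₀ * (Real.exp γ - (K + 1) + K * Real.exp (-γ))) / γ := by
    intro γ hγ
    rw [le_div_iff₀ hγ]
    have h1 := mul_le_mul_of_nonneg_left (htan γ) hl0.le
    have h2 : A / Real.log K = lam₀ * (K - 1) := by
      rw [← hl0A]; field_simp
    rw [h2]
    nlinarith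
  have hup : ∀ μ : ℝ, 0 < μ → cstark μ ≤ A / Real.log K := by
    intro μ hμ
    apply (hcstark μ hμ).2
    refine ⟨Real.log K, hL, ?_⟩
    rw [Real.exp_neg, Real.exp_log hk0, mul_inv_cancel₀ hk0.ne']
    congr 1
    ring
  refine ⟨?_, ?_, ?_⟩
  · rw [hlam₀, hlamc]
    have hs1 : 1 < Real.sqrt K := by
      rw [Real.lt_sqrt (by norm_num)]; linarith
    have hsq : Real.sqrt K ^ 2 = K := Real.sq_sqrt hk0.le
    have hlog : Real.log K = 2 * Real.log (Real.sqrt K) := by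
      rw [Real.log_sqrt hk0.le]; ring
    rw [hlog]
    generalize Real.sqrt K = s at *
    have hls := Real.one_sub_inv_le_log_of_pos (show 0 < s by linarith)
    have hs : s * (1 - s⁻¹) = s - 1 := by field_simp
    have h5 : s - 1 ≤ s * Real.log s := by
      rw [← hs]; exact mul_le_mul_of_nonneg_left hls (by linarith)
    have hlp : 0 < Real.log s := Real.log_pos hs1
    subst hsq
    apply div_lt_div_of_pos_left hA
    · nlinarith [mul_pos (sub_pos.2 hs1) (sub_pos.2 hs1)]
    · nlinarith [mul_pos (sub_pos.2 hs1) hlp,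
        mul_pos (sub_pos.2 hs1) (show 0 < (s + 1) * (2 * Real.log s) - (s - 1) by nlinarith)]
  · intro a ha b hb hab
    obtain ⟨γ, hγ, hv⟩ := (hcstark b hb.1).1
    have hmem := (hcstark a ha.1).2 ⟨γ, hγ, rfl⟩
    have h1 := hlow γ hγ
    have h2 := hup b hb.1
    generalize Real.exp γ - (K + 1) + K * Real.exp (-γ) = f at *
    have hf : 0 ≤ f := by
      by_contra! hf
      have : (A + lam₀ * f) / γ < (A + b * f) / γ := by
        apply div_lt_div_of_pos_right _ hγ
        nlinarith [mul_lt_mul_of_neg_right hb.2 hf]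
      linarith
    rw [hv]
    refine hmem.trans (div_le_div_of_nonneg_right ?_ hγ.le)
    nlinarith [mul_le_mul_of_nonneg_right hab hf]
  · intro a ha b hb hab
    have ha0 : 0 < a := hl0.trans ha.1
    have hb0 : 0 < b := hl0.trans hb.1
    obtain ⟨γ, hγ, hv⟩ := (hcstark a ha0).1
    have hmem := (hcstark b hb0).2 ⟨γ, hγ, rfl⟩
    have h1 := hlow γ hγ
    have h2 := hup a ha0
    generalize Real.exp γ - (K + 1) + K * Real.exp (-γ) = f at *
    have hf : f ≤ 0 := by
      by_contra! hf
      have : (A + lam₀ * f) / γ < (A + a * f) / γ := by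
        apply div_lt_div_of_pos_right _ hγ
        nlinarith [mul_lt_mul_of_pos_right ha.1 hf]
      linarith
    rw [hv]
    refine hmem.trans (div_le_div_of_nonneg_right ?_ hγ.le)
    nlinarith [mul_le_mul_of_nonpos_right hab hf]
end

section
/- Let k ≥ 2 be an integer, assume 𝓡₀ > 1, and set λ₀ := η(𝓡₀ - 1)/((k-1) ln k). Then the spreading speed at λ = λ₀ satisfies c_*^k(λ₀) := min_{γ>0} [η(𝓡₀ - 1) + λ₀(e^{γ} - (k+1) + k e^{-γ})]/γ = η(𝓡₀ - 1)/ln k. -/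
/-- For `k ≥ 2` and `𝓡₀ = s₀τ/η > 1`, at `λ₀ = η(𝓡₀-1)/((k-1) ln k)` the spreading
speed equals `c_*^k(λ₀) = min_{γ>0} [η(𝓡₀-1) + λ₀(e^γ - (k+1) + k e^{-γ})]/γ
= η(𝓡₀-1)/ln k`. -/
theorem stmt_18 (τ η s₀ : ℝ) (hτ : 0 < τ) (hη : 0 < η)
    (hs₀ : s₀ ∈ Set.Ioo (0 : ℝ) 1) (hR0 : 1 < s₀ * τ / η)
    (k : ℕ) (hk : 2 ≤ k)
    (lam₀ : ℝ)
    (hlam₀ : lam₀ = η * (s₀ * τ / η - 1) / (((k : ℝ) - 1) * Real.log k)) :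
    IsLeast {v : ℝ | ∃ γ : ℝ, 0 < γ ∧
        v = (η * (s₀ * τ / η - 1)
          + lam₀ * (Real.exp γ - ((k : ℝ) + 1) + (k : ℝ) * Real.exp (-γ))) / γ}
      (η * (s₀ * τ / η - 1) / Real.log k) := by
  have hk2 : (2 : ℝ) ≤ k := by exact_mod_cast hk
  have hk0 : (0 : ℝ) < k := by linarith
  have hL : 0 < Real.log k := Real.log_pos (by linarith)
  have hA : 0 < η * (s₀ * τ / η - 1) := mul_pos hη (by linarith)
  generalize η * (s₀ * τ / η - 1) = A at *
  have hk1 : (0 : ℝ) < k - 1 := by linarith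
  have hl : 0 < lam₀ := by rw [hlam₀]; positivity
  have hAl : A = lam₀ * ((k - 1) * Real.log k) := by
    rw [hlam₀]; field_simp
  constructor
  · refine ⟨Real.log k, hL, ?_⟩
    rw [Real.exp_neg, Real.exp_log hk0, mul_inv_cancel₀ hk0.ne']
    ring
  · rintro v ⟨γ, hγ, rfl⟩
    have e1 : Real.exp γ = k * Real.exp (γ - Real.log k) := by
      rw [Real.exp_sub, Real.exp_log hk0]; field_simp
    have e2 : k * Real.exp (-γ) = Real.exp (-(γ - Real.log k)) := by
      rw [neg_sub, sub_eq_add_neg, Real.exp_add, Real.exp_log hk0]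
    have h1 := mul_le_mul_of_nonneg_left (Real.add_one_le_exp (γ - Real.log k)) hk0.le
    have h2 := Real.add_one_le_exp (-(γ - Real.log k))
    have hdiv : A / Real.log k = lam₀ * (k - 1) := by
      rw [hAl]; field_simp
    rw [hdiv, le_div_iff₀ hγ, e2, e1, hAl, mul_assoc, ← mul_add]
    apply mul_le_mul_of_nonneg_left _ hl.le
    linarith
end

section
/- Assume 𝓡₀ > 1 and regard c_*(λ) := min_{γ>0} [η(𝓡₀ - 1) + λ(e^{-γ} - 2 + e^{γ})]/γ as a function of λ > 0. Then c_*(λ) is asymptotically equivalent to 2√(η(𝓡₀ - 1) λ) as λ → +∞, i.e. lim_{λ→+∞} c_*(λ)/(2√(η(𝓡₀ - 1) λ)) = 1. -/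
/-- Assume `𝓡₀ = s₀τ/η > 1` and let, for `λ > 0`,
`c_*(λ) = min_{γ>0} [η(𝓡₀-1) + λ(e^{-γ} - 2 + e^γ)]/γ` be the spreading speed on
the lattice `ℤ`. Then `c_*(λ) ∼ 2√(η(𝓡₀-1)λ)` as `λ → +∞`, i.e.
`c_*(λ)/(2√(η(𝓡₀-1)λ)) → 1`. -/
theorem stmt_19 (τ η s₀ : ℝ) (hτ : 0 < τ) (hη : 0 < η)
    (hs₀ : s₀ ∈ Set.Ioo (0 : ℝ) 1) (hR0 : 1 < s₀ * τ / η)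
    (cstar : ℝ → ℝ)
    (hcstar : ∀ μ : ℝ, 0 < μ →
      IsLeast {v : ℝ | ∃ γ : ℝ, 0 < γ ∧
        v = (η * (s₀ * τ / η - 1) + μ * (Real.exp (-γ) - 2 + Real.exp γ)) / γ}
        (cstar μ)) :
    Filter.Tendsto
      (fun μ : ℝ => cstar μ / (2 * Real.sqrt (η * (s₀ * τ / η - 1) * μ)))
      Filter.atTop (nhds 1) := by
  obtain ⟨A, hAdef⟩ : ∃ A, A = η * (s₀ * τ / η - 1) := ⟨_, rfl⟩
  rw [← hAdef] at hcstar ⊢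
  have hA : 0 < A := by
    rw [hAdef]; exact mul_pos hη (by linarith)
  have hlow : ∀ γ : ℝ, 0 < γ → γ ^ 2 ≤ Real.exp (-γ) - 2 + Real.exp γ := by
    intro γ hγ
    have h1 : γ / 2 ≤ Real.sinh (γ / 2) := Real.self_le_sinh_iff.2 (by linarith)
    have h2 : Real.exp (-γ) - 2 + Real.exp γ = 4 * Real.sinh (γ / 2) ^ 2 := by
      have h3 := Real.cosh_two_mul (γ / 2)
      have h4 := Real.cosh_sq (γ / 2)
      have h5 := Real.cosh_eq γ
      rw [show 2 * (γ / 2) = γ by ring] at h3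
      linarith
    rw [h2]
    nlinarith
  have hup : ∀ γ : ℝ, 0 < γ → γ ≤ 1 →
      Real.exp (-γ) - 2 + Real.exp γ ≤ γ ^ 2 + γ ^ 4 / 2 := by
    intro γ hγ hγ1
    have h1 := Real.cosh_le_exp_half_sq γ
    have h5 := Real.cosh_eq γ
    have h6 : |γ ^ 2 / 2| ≤ 1 := by
      rw [abs_of_nonneg (by positivity)]; nlinarith
    have h7 := (abs_le.1 (Real.abs_exp_sub_one_sub_id_le h6)).2
    nlinarith
  have hlim : Filter.Tendsto (fun μ : ℝ => 1 + A / 4 / μ) Filter.atTop (nhds 1) := by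
    simpa using (tendsto_const_nhds (x := (1 : ℝ))).add
      (Filter.Tendsto.const_div_atTop (Filter.tendsto_id (α := ℝ)) (A / 4))
  refine tendsto_of_tendsto_of_tendsto_of_le_of_le' tendsto_const_nhds hlim ?_ ?_
  · filter_upwards [Filter.eventually_gt_atTop 0] with μ hμ
    obtain ⟨⟨γ, hγ, hv⟩, -⟩ := hcstar μ hμ
    have hs : 0 < Real.sqrt (A * μ) := Real.sqrt_pos.2 (by positivity)
    have hs2 : Real.sqrt (A * μ) ^ 2 = A * μ := Real.sq_sqrt (by positivity)
    set s := Real.sqrt (A * μ)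
    rw [le_div_iff₀ (by positivity), hv, le_div_iff₀ hγ]
    have h1 := mul_le_mul_of_nonneg_left (hlow γ hγ) hμ.le
    have h2 : 2 * s * γ ≤ A + μ * γ ^ 2 := by
      have h3 : 0 ≤ (μ * γ - s) ^ 2 := sq_nonneg _
      have h4 : 0 ≤ μ * (A + μ * γ ^ 2 - 2 * s * γ) := by nlinarith
      have := nonneg_of_mul_nonneg_right h4 hμ
      linarith
    linarith
  · filter_upwards [Filter.eventually_gt_atTop 0, Filter.eventually_ge_atTop A] with μ hμ hμA
    have hs : 0 < Real.sqrt (A * μ) := Real.sqrt_pos.2 (by positivity)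
    have hs2 : Real.sqrt (A * μ) ^ 2 = A * μ := Real.sq_sqrt (by positivity)
    set s := Real.sqrt (A * μ)
    have hγ : 0 < s / μ := by positivity
    have hγ1 : s / μ ≤ 1 := by
      rw [div_le_one hμ]; nlinarith
    have hle := (hcstar μ hμ).2 ⟨s / μ, hγ, rfl⟩
    have h1 := mul_le_mul_of_nonneg_left (hup _ hγ hγ1) hμ.le
    rw [div_le_iff₀ (by positivity)]
    refine hle.trans ?_
    rw [div_le_iff₀ hγ]
    have e2 : (s / μ) ^ 2 = A / μ := by
      rw [div_pow, hs2]; field_simp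
    have e4 : (s / μ) ^ 4 = (A / μ) ^ 2 := by
      rw [← e2]; ring
    rw [e2, e4] at h1
    have e5 : (1 + A / 4 / μ) * (2 * s) * (s / μ) = A + μ * (A / μ + (A / μ) ^ 2 / 2) := by
      have : (1 + A / 4 / μ) * (2 * s) * (s / μ) = (1 + A / 4 / μ) * 2 * s ^ 2 / μ := by ring
      rw [this, hs2]; field_simp; ring
    linarith
end
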